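/- arXiv:math/9705226 — 5 statements merged into one kernel-verified Lean document; each statement's English description precedes it below -/
import Mathlib

section
/- Assume λ is a cardinal with λ ≤ 2^ℵ₀ and Pr★(λ) holds, i.e. there exists an algebra M on λ (a first-order structure with universe λ in a language with countably many function symbols and no relation symbols) such that for every sequence ⟨α_n : n < ω⟩ of elements of λ, for all but finitely many n one has α_n ∈ cl_M({α_k : n < k < ω}). Then the pair (λ, ℵ₀) has the Kalikow property. -/
open Cardinal Filter

universe u v

/-- An algebra (first-order structure with only function symbols) whose
function symbols are indexed by `ι`, on the universe `α`.  Each symbol `i`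
has a finite arity `arity i` and is interpreted by `op i`. -/
structure AlgebraOn (ι : Type v) (α : Type u) where
  arity : ι → ℕ
  op : (i : ι) → (Fin (arity i) → α) → α

/-- The closure of a set `X ⊆ α` under the operations of the algebra `M`:
the universe of the substructure generated by `X`. -/
def AlgebraOn.cl {ι : Type v} {α : Type u} (M : AlgebraOn ι α) (X : Set α) : Set α :=
  ⋂₀ {Y : Set α | X ⊆ Y ∧
      ∀ (i : ι) (v : Fin (M.arity i) → α), (∀ j, v j ∈ Y) → M.op i v ∈ Y}

/-- Condition `(★)⁰_M`: for every `ω`-sequence of elements, all but finitely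
many of its terms belong to the closure of the set of strictly later terms. -/
def Star0 {ι : Type v} {α : Type u} (M : AlgebraOn ι α) : Prop :=
  ∀ a : ℕ → α, ∀ᶠ n in Filter.atTop, a n ∈ M.cl (a '' Set.Ioi n)

/-- Condition `(★)¹_M`: there is no `ω`-sequence of countably infinite subsets
whose closures are strictly decreasing. -/
def Star1 {ι : Type v} {α : Type u} (M : AlgebraOn ι α) : Prop :=
  ¬ ∃ A : ℕ → Set α,
      (∀ n, (A n).Countable ∧ (A n).Infinite) ∧
      (∀ n, M.cl (A (n + 1)) ⊂ M.cl (A n))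

/-- Condition `(★)²_M`: every countably infinite set has a countably infinite
subset all of whose countably infinite subsets generate the same closure. -/
def Star2 {ι : Type v} {α : Type u} (M : AlgebraOn ι α) : Prop :=
  ∀ A : Set α, A.Countable → A.Infinite →
    ∃ B : Set α, B ⊆ A ∧ B.Countable ∧ B.Infinite ∧
      ∀ C : Set α, C ⊆ B → C.Countable → C.Infinite → M.cl B = M.cl C

/-- `Pr★(λ)`: there is an algebra on `λ` with countably many function symbols
satisfying `(★)⁰`. -/
def PrStar (lam : Cardinal.{u}) : Prop :=
  ∃ M : AlgebraOn ℕ lam.out, Star0 M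

/-- `Pr★(λ, κ)`: there is an algebra on `λ` with at most `κ` function symbols
satisfying `(★)⁰`. -/
def PrStarK (lam kap : Cardinal.{u}) : Prop :=
  ∃ (ι : Type u) (M : AlgebraOn ι lam.out), #ι ≤ kap ∧ Star0 M

/-- The pair `(λ, κ)` has the Kalikow property: there are functions
`F n : (^n λ) → κ` such that, with `F η n = F n (η ↾ n)`, two `ω`-sequences
over `λ` are eventually equal iff their images are eventually equal. -/
def HasKalikow (lam kap : Cardinal.{u}) : Prop :=
  ∃ F : (n : ℕ) → (Fin n → lam.out) → kap.out,
    ∀ η ν : ℕ → lam.out,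
      (∀ᶠ n in Filter.atTop, η n = ν n) ↔
        (∀ᶠ n in Filter.atTop,
          F n (fun i => η i.1) = F n (fun i => ν i.1))

theorem AlgebraOn.cl_mono {ι : Type v} {α : Type u} (M : AlgebraOn ι α) {X Y : Set α}
    (h : X ⊆ Y) : M.cl X ⊆ M.cl Y :=
  Set.sInter_subset_sInter fun _ hZ => ⟨h.trans hZ.1, hZ.2⟩

/-- The terms of an algebra with countably many operations, in the variables `x 0, x 1, …`,
form a countable family of functions, each depending on finitely many variables, which
exhausts the closure of the range of `x`. -/
theorem AlgebraOn.exists_term_functions {α : Type u} (M : AlgebraOn ℕ α) :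
    ∃ g : ℕ → (ℕ → α) → α,
      (∀ c, ∃ b, ∀ x y : ℕ → α, (∀ i < b, x i = y i) → g c x = g c y) ∧
      ∀ x : ℕ → α, ∀ a ∈ M.cl (Set.range x), ∃ c, g c x = a := by
  let β : ℕ ⊕ ℕ → Type := fun s => Fin (Sum.elim (fun _ => 0) M.arity s)
  let ev : (ℕ → α) → WType β → α := fun x =>
    WType.elim α fun p => match p with
      | ⟨Sum.inl n, _⟩ => x n
      | ⟨Sum.inr i, v⟩ => M.op i v
  have : Nonempty (WType β) := ⟨WType.mk (Sum.inl 0) Fin.elim0⟩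
  obtain ⟨r, hr⟩ := exists_surjective_nat (WType β)
  refine ⟨fun c x => ev x (r c), fun c => ?_, fun x a ha => ?_⟩
  · change ∃ b, ∀ x y : ℕ → α, (∀ i < b, x i = y i) → ev x (r c) = ev y (r c)
    generalize r c = t
    induction t with
    | mk s f ih =>
      cases s with
      | inl n => exact ⟨n + 1, fun x y h => h n n.lt_succ_self⟩
      | inr i =>
        choose b hb using ih
        refine ⟨Finset.univ.sup b, fun x y h => congrArg (M.op i) (funext fun j => ?_)⟩
        exact hb j x y fun l hl => h l (hl.trans_le (Finset.le_sup (Finset.mem_univ j)))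
  · have key : a ∈ Set.range (ev x) := by
      refine ha _ ⟨?_, fun i v hv => ?_⟩
      · rintro _ ⟨n, rfl⟩
        exact ⟨WType.mk (Sum.inl n) Fin.elim0, rfl⟩
      · choose f hf using hv
        exact ⟨WType.mk (Sum.inr i) f, congrArg (M.op i) (funext hf)⟩
    obtain ⟨t, rfl⟩ := key
    obtain ⟨c, rfl⟩ := hr t
    exact ⟨c, rfl⟩

namespace Kalikow

section

variable {α : Type u}

/-- The sequence `x` with all entries outside the open interval `(k, m)` replaced by `d`. -/
def mask (d : α) (k m : ℕ) (x : ℕ → α) : ℕ → α :=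
  fun i => if k < i ∧ i < m then x i else d

theorem mask_congr (d : α) {k m : ℕ} {x y : ℕ → α} (h : ∀ i, k < i → i < m → x i = y i) :
    mask d k m x = mask d k m y := by
  funext i
  unfold mask
  split_ifs with hi
  · exact h i hi.1 hi.2
  · rfl

/-- The function `g c` recovers the entry `x k` from the entries in `(k, m)`. -/
def Recovers (g : ℕ → (ℕ → α) → α) (d : α) (x : ℕ → α) (k m c : ℕ) : Prop :=
  k < m ∧ c < m ∧ g c (mask d k m x) = x k

/-- `m` is the first stage at which some `g c` recovers `x k`. -/
def FirstStage (g : ℕ → (ℕ → α) → α) (d : α) (x : ℕ → α) (k m : ℕ) : Prop :=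
  (∃ c, Recovers g d x k m c) ∧ ∀ m' < m, ¬ ∃ c, Recovers g d x k m' c

theorem FirstStage.lt {g : ℕ → (ℕ → α) → α} {d : α} {x : ℕ → α} {k m : ℕ}
    (h : FirstStage g d x k m) : k < m :=
  h.1.choose_spec.1

theorem FirstStage.unique {g : ℕ → (ℕ → α) → α} {d : α} {x : ℕ → α} {k m m' : ℕ}
    (h : FirstStage g d x k m) (h' : FirstStage g d x k m') : m = m' := by
  rcases lt_trichotomy m m' with hlt | heq | hlt
  · exact absurd h.1 (h'.2 m hlt)
  · exact heq
  · exact absurd h'.1 (h.2 m' hlt)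

theorem recovers_congr (g : ℕ → (ℕ → α) → α) (d : α) {x y : ℕ → α} {k m : ℕ}
    (h : ∀ i, k ≤ i → i < m → x i = y i) (c : ℕ) :
    Recovers g d x k m c ↔ Recovers g d y k m c := by
  unfold Recovers
  refine and_congr_right fun hk => and_congr_right fun _ => ?_
  rw [mask_congr d fun i hi => h i hi.le, h k le_rfl hk]

theorem firstStage_congr (g : ℕ → (ℕ → α) → α) (d : α) {x y : ℕ → α} {k m : ℕ}
    (h : ∀ i, k ≤ i → i < m → x i = y i) :
    FirstStage g d x k m ↔ FirstStage g d y k m := by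
  refine and_congr (exists_congr (recovers_congr g d h))
    (forall₂_congr fun m' hm' => not_congr (exists_congr
      (recovers_congr g d fun i hi hi' => h i hi (hi'.trans hm'))))

/-- Starting from `x`, recompute the entries `k, k - 1, …` (`t` of them) in this order, the
entry `i` by `g (c i)` from the entries in `(i, s i)`. -/
def recompute (g : ℕ → (ℕ → α) → α) (d : α) (c s : ℕ → ℕ) (k : ℕ) (x : ℕ → α) : ℕ → ℕ → α
  | 0 => x
  | t + 1 => Function.update (recompute g d c s k x t) (k - t)
      (g (c (k - t)) (mask d (k - t) (s (k - t)) (recompute g d c s k x t)))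

theorem recompute_eq {g : ℕ → (ℕ → α) → α} {d : α} {c s : ℕ → ℕ} {x : ℕ → α} {n k m : ℕ}
    (hr : ∀ i, n ≤ i → i ≤ k → Recovers g d x i (s i) (c i))
    (hs : ∀ i, n ≤ i → i ≤ k → s i ≤ m) (t : ℕ) (ht : t + n ≤ k + 1) :
    ∀ j, k + 1 ≤ j + t → j < m → recompute g d c s k (mask d k m x) t j = x j := by
  induction t with
  | zero =>
    intro j hj hjm
    exact if_pos ⟨by omega, hjm⟩
  | succ t ih =>
    intro j hj hjm
    have ih := ih (by omega)
    rw [recompute]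
    by_cases h : j = k - t
    · subst h
      have hm := hs (k - t) (by omega) (by omega)
      rw [Function.update_self, ← (hr (k - t) (by omega) (by omega)).2.2]
      exact congrArg _ (mask_congr d fun i hi hi' => ih i (by omega) (by omega))
    · rw [Function.update_of_ne h]
      exact ih j (by omega) hjm

/-- The finite type of the information revealed at stage `m`. -/
abbrev Info (m : ℕ) : Type :=
  (Fin m → Fin m → Prop) ×
    (Fin m → (Fin m → Fin (m + 1) × Fin (m + 1)) → Fin (m + 1) → Fin m → Prop)

/-- Extend a function on `Fin m` by zero. -/
def extend {m l : ℕ} (u : Fin m → Fin (l + 1)) (i : ℕ) : ℕ :=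
  if h : i < m then u ⟨i, h⟩ else 0

/-- The information on `x` revealed at stage `m`.  For every `k` having `m` as its first stage,
it tells which functions recover `x k` and, for all possible ways of recomputing earlier
entries from those in `(k, m)`, the first `m` bits of the result. -/
def info (g : ℕ → (ℕ → α) → α) (d : α) (e : α → ℕ → Prop) (m : ℕ) (x : ℕ → α) : Info m :=
  (fun k c => FirstStage g d x k m ∧ Recovers g d x k m c,
   fun k u t b => FirstStage g d x k m ∧
    e (recompute g d (extend fun i => (u i).1) (extend fun i => (u i).2) k
      (mask d k m x) t (k + 1 - t)) b)

theorem info_congr (g : ℕ → (ℕ → α) → α) (d : α) (e : α → ℕ → Prop) {m : ℕ} {x y : ℕ → α}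
    (h : ∀ k < m, (∀ i, k ≤ i → i < m → x i = y i) ∨
      ¬ FirstStage g d x k m ∧ ¬ FirstStage g d y k m) :
    info g d e m x = info g d e m y := by
  refine Prod.ext (funext₂ fun k c => propext ?_)
    (funext₂ fun k u => funext₂ fun t b => propext ?_)
  · rcases h k k.2 with h | h
    · exact and_congr (firstStage_congr g d h) (recovers_congr g d h c)
    · simp [info, h.1, h.2]
  · rcases h k k.2 with h | h
    · simp only [info]
      rw [firstStage_congr g d h, mask_congr d fun i hi => h i hi.le]
    · simp [info, h.1, h.2]

theorem info_eventually_eq (g : ℕ → (ℕ → α) → α) (d : α) (e : α → ℕ → Prop) {x y : ℕ → α}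
    (h : ∀ᶠ n in atTop, x n = y n) : ∀ᶠ m in atTop, info g d e m x = info g d e m y := by
  obtain ⟨N, hN⟩ := eventually_atTop.1 h
  have key : ∀ z : ℕ → α, ∀ᶠ m in atTop, ∀ k < N, ¬ FirstStage g d z k m := by
    intro z
    refine (Set.finite_lt_nat N).eventually_all.2 fun k _ => ?_
    by_cases hk : ∃ m, FirstStage g d z k m
    · obtain ⟨m, hm⟩ := hk
      filter_upwards [eventually_gt_atTop m] with m' hm' hf
      exact hm'.ne (hm.unique hf)
    · exact Eventually.of_forall fun m hm => hk ⟨m, hm⟩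
  filter_upwards [key x, key y] with m hx hy
  refine info_congr g d e fun k _ => ?_
  by_cases hk : k < N
  · exact Or.inr ⟨hx k hk, hy k hk⟩
  · exact Or.inl fun i hi _ => hN i (by omega)

theorem eventually_eq_of_info {g : ℕ → (ℕ → α) → α} {d : α} {e : α → ℕ → Prop}
    (he : Function.Injective e) {x y : ℕ → α}
    (hx : ∀ᶠ k in atTop, ∃ m c, Recovers g d x k m c)
    (h : ∀ᶠ m in atTop, info g d e m x = info g d e m y) : ∀ᶠ n in atTop, x n = y n := by
  obtain ⟨N₁, hN₁⟩ := eventually_atTop.1 hx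
  obtain ⟨N₂, hN₂⟩ := eventually_atTop.1 h
  have key : ∀ k, ∃ m c, max N₁ N₂ ≤ k →
      FirstStage g d x k m ∧ FirstStage g d y k m ∧
        Recovers g d x k m c ∧ Recovers g d y k m c := by
    intro k
    by_cases hk : max N₁ N₂ ≤ k
    · classical
      have hex := hN₁ k ((le_max_left _ _).trans hk)
      have hf : FirstStage g d x k (Nat.find hex) :=
        ⟨Nat.find_spec hex, fun m' hm' => Nat.find_min hex hm'⟩
      obtain ⟨c, hc⟩ := hf.1
      have hI := hN₂ _ (((le_max_right _ _).trans hk).trans hf.lt.le)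
      have hy := (congrFun (congrFun (congrArg Prod.fst hI) ⟨k, hf.lt⟩) ⟨c, hc.2.1⟩).mp ⟨hf, hc⟩
      exact ⟨_, c, fun _ => ⟨hf, hy.1, hc, hy.2⟩⟩
    · exact ⟨0, 0, fun h => absurd h hk⟩
  choose s c hsc using key
  filter_upwards [eventually_ge_atTop (max N₁ N₂)] with n hn
  refine he (funext fun b => ?_)
  have hex : ∃ k, n ≤ k ∧ b < s k :=
    ⟨n + b, by omega, lt_of_le_of_lt (by omega) (hsc (n + b) (by omega)).1.lt⟩
  obtain ⟨k, ⟨hnk, hbk⟩, hmin⟩ :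
      ∃ k, (n ≤ k ∧ b < s k) ∧ ∀ i < k, ¬ (n ≤ i ∧ b < s i) := by
    classical
    exact ⟨Nat.find hex, Nat.find_spec hex, fun i hi => Nat.find_min hex hi⟩
  have hs : ∀ i, n ≤ i → i ≤ k → s i ≤ s k := by
    intro i hi hik
    rcases hik.lt_or_eq with hlt | rfl
    · have := hmin i hlt
      omega
    · exact le_rfl
  have hks : k < s k := (hsc k (by omega)).1.lt
  let u : Fin (s k) → Fin (s k + 1) × Fin (s k + 1) :=
    fun i => (Fin.ofNat _ (c i), Fin.ofNat _ (s i))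
  have hu : ∀ i, n ≤ i → i ≤ k →
      extend (fun i => (u i).1) i = c i ∧ extend (fun i => (u i).2) i = s i := by
    intro i hi hik
    have h₁ := hs i hi hik
    have h₂ := (hsc i (by omega)).2.2.1.2.1
    have h₃ : i < s k := by omega
    simp only [extend, h₃, dite_true, u, Fin.val_ofNat]
    exact ⟨Nat.mod_eq_of_lt (by omega), Nat.mod_eq_of_lt (by omega)⟩
  have hI := hN₂ (s k) (by omega)
  have hb := congrFun (congrFun (congrFun (congrFun (congrArg Prod.snd hI) ⟨k, hks⟩) u)
    ⟨k + 1 - n, by omega⟩) ⟨b, hbk⟩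
  have hval : ∀ z : ℕ → α, (∀ i, n ≤ i → i ≤ k → Recovers g d z i (s i) (c i)) →
      recompute g d (extend fun i => (u i).1) (extend fun i => (u i).2) k
        (mask d k (s k) z) (k + 1 - n) (k + 1 - (k + 1 - n)) = z n := by
    intro z hz
    have hn' : k + 1 - (k + 1 - n) = n := by omega
    rw [hn']
    refine recompute_eq (n := n) (fun i hi hik => ?_) (fun i hi hik => ?_) _ (by omega) n
      (by omega) (by omega)
    · rw [(hu i hi hik).1, (hu i hi hik).2]
      exact hz i hi hik
    · rw [(hu i hi hik).2]
      exact hs i hi hik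
  simp only [info] at hb
  rw [hval x fun i hi _ => (hsc i (by omega)).2.2.1,
    hval y fun i hi _ => (hsc i (by omega)).2.2.2] at hb
  have hk := hsc k (by omega)
  simpa [hk.1, hk.2.1] using hb

theorem exists_recovers {M : AlgebraOn ℕ α} {g : ℕ → (ℕ → α) → α} (d : α)
    (hfin : ∀ c, ∃ b, ∀ x y : ℕ → α, (∀ i < b, x i = y i) → g c x = g c y)
    (hcl : ∀ x : ℕ → α, ∀ a ∈ M.cl (Set.range x), ∃ c, g c x = a)
    {x : ℕ → α} {k : ℕ} (hk : x k ∈ M.cl (x '' Set.Ioi k)) :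
    ∃ m c, Recovers g d x k m c := by
  obtain ⟨c, hc⟩ := hcl (fun i => if k < i then x i else d) (x k) (by
    refine M.cl_mono ?_ hk
    rintro _ ⟨i, hi, rfl⟩
    exact ⟨i, if_pos hi⟩)
  obtain ⟨b, hb⟩ := hfin c
  refine ⟨b + k + c + 1, c, by omega, by omega, ?_⟩
  rw [← hc]
  refine hb _ _ fun i hi => ?_
  have : i < b + k + c + 1 := by omega
  simp [mask, this]

end

end Kalikow

open Kalikow in
/-- If `λ ≤ 2^ℵ₀` and `Pr★(λ)` holds then `KL(λ, ℵ₀)`. -/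
theorem prStar_implies_kalikow_aleph0 (lam : Cardinal.{u})
    (hle : lam ≤ 2 ^ Cardinal.aleph0.{u}) (h : PrStar lam) :
    HasKalikow lam Cardinal.aleph0.{u} := by
  have : Infinite Cardinal.aleph0.{u}.out := by
    rw [Cardinal.infinite_iff, Cardinal.mk_out]
  let toOut := Infinite.natEmbedding Cardinal.aleph0.{u}.out
  rcases isEmpty_or_nonempty lam.out with hemp | ⟨⟨d⟩⟩
  · exact ⟨fun _ _ => toOut 0, fun η => isEmptyElim (η 0)⟩
  obtain ⟨M, hM⟩ := h
  obtain ⟨g, hfin, hcl⟩ := M.exists_term_functions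
  obtain ⟨f⟩ : Nonempty (lam.out ↪ Set (ULift.{u} ℕ)) := by
    rw [← Cardinal.le_def, Cardinal.mk_out, Cardinal.mk_set]
    simpa using hle
  let e : lam.out → ℕ → Prop := fun a b => ULift.up b ∈ f a
  have he : Function.Injective e := fun a a' haa =>
    f.injective (Set.ext fun b => iff_of_eq (congrFun haa b.down))
  choose code hcode using fun m => exists_injective_nat (Info m)
  refine ⟨fun m p => toOut (code m (info g d e m fun i => if h : i < m then p ⟨i, h⟩ else d)),
    fun η ν => ?_⟩
  have hF : ∀ (m : ℕ) (ξ : ℕ → lam.out),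
      (info g d e m fun i => if _ : i < m then ξ i else d) = info g d e m ξ := fun m ξ =>
    info_congr g d e fun k _ => Or.inl fun i _ hi => dif_pos hi
  simp only [hF, toOut.injective.eq_iff, (hcode _).eq_iff]
  exact ⟨info_eventually_eq g d e, eventually_eq_of_info he
    ((hM η).mono fun k hk => exists_recovers d hfin hcl hk)⟩
end

section
/- Assume λ is a cardinal with λ ≤ 2^ℵ₀ and Pr★(λ) holds, i.e. there exists an algebra M on λ (a first-order structure with universe λ in a language with countably many function symbols and no relation symbols) such that for every sequence ⟨α_n : n < ω⟩ of elements of λ, for all but finitely many n one has α_n ∈ cl_M({α_k : n < k < ω}). Then the pair (λ, 2) has the Kalikow property. -/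
open Cardinal Filter

universe u v

/-- Terms over an algebra with arities `ar`: either a variable or an application of a symbol. -/
abbrev AlgTerm (ar : ℕ → ℕ) : Type :=
  WType fun s : ℕ ⊕ ℕ => Fin (Sum.elim (fun _ => 0) ar s)

/-- The value of a term under an assignment of the variables. -/
def AlgebraOn.eval {α : Type u} (M : AlgebraOn ℕ α) (σ : ℕ → α) : AlgTerm M.arity → α
  | ⟨.inl k, _⟩ => σ k
  | ⟨.inr i, f⟩ => M.op i fun j => M.eval σ (f j)

theorem AlgebraOn.exists_eval_of_mem_cl {α : Type u} (M : AlgebraOn ℕ α) (σ : ℕ → α) {x : α}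
    (hx : x ∈ M.cl (Set.range σ)) : ∃ t, M.eval σ t = x := by
  refine hx (Set.range (M.eval σ)) ⟨?_, ?_⟩
  · rintro _ ⟨k, rfl⟩
    exact ⟨⟨.inl k, Fin.elim0⟩, rfl⟩
  · intro i v hv
    choose f hf using hv
    refine ⟨⟨.inr i, f⟩, ?_⟩
    change M.op i (fun j => M.eval σ (f j)) = _
    simp only [hf]

theorem AlgebraOn.eval_local {α : Type u} (M : AlgebraOn ℕ α) (t : AlgTerm M.arity) :
    ∃ N, ∀ σ τ : ℕ → α, (∀ k < N, σ k = τ k) → M.eval σ t = M.eval τ t := by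
  induction t with
  | mk s f ih =>
    cases s with
    | inl k => exact ⟨k + 1, fun σ τ h => h k k.lt_succ_self⟩
    | inr i =>
      choose N hN using ih
      refine ⟨Finset.univ.sup N, fun σ τ h => congrArg (M.op i) (funext fun j => ?_)⟩
      exact hN j σ τ fun k hk => h k (hk.trans_le (Finset.le_sup (Finset.mem_univ j)))

/-- Drop the first `n` entries of a sequence. -/
def seqDrop {α : Type u} (n : ℕ) (η : ℕ → α) : ℕ → α := fun k => η (n + k)

/-- Put a new entry in front of a sequence. -/
def seqCons {α : Type u} (x : α) (σ : ℕ → α) : ℕ → α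
  | 0 => x
  | k + 1 => σ k

theorem seqCons_drop {α : Type u} (η : ℕ → α) (n : ℕ) :
    seqCons (η n) (seqDrop (n + 1) η) = seqDrop n η := by
  funext k
  cases k with
  | zero => rfl
  | succ k => exact congrArg η (by omega)

theorem Star0.exists_witnesses {α : Type u} [Nonempty α] {M : AlgebraOn ℕ α} (h : Star0 M) :
    ∃ T : ℕ → (ℕ → α) → α,
      (∀ c σ τ, (∀ k < c, σ k = τ k) → T c σ = T c τ) ∧
      ∀ η : ℕ → α, ∀ᶠ n in atTop, ∃ c, T c (seqDrop (n + 1) η) = η n := by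
  classical
  have : Nonempty (AlgTerm M.arity) := ⟨⟨.inl 0, Fin.elim0⟩⟩
  obtain ⟨e, he⟩ := exists_surjective_nat (AlgTerm M.arity)
  let z : α := Classical.arbitrary α
  refine ⟨fun c σ => M.eval (fun k => if k < c then σ k else z) (e c.unpair.1), ?_, ?_⟩
  · intro c σ τ hst
    have : (fun k => if k < c then σ k else z) = fun k => if k < c then τ k else z := by
      funext k
      split_ifs with hk
      · exact hst k hk
      · rfl
    simp only [this]
  · intro η
    filter_upwards [h η] with n hn
    have himg : η '' Set.Ioi n = Set.range (seqDrop (n + 1) η) := by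
      ext x
      constructor
      · rintro ⟨k, hk, rfl⟩
        have hk' : n < k := hk
        exact ⟨k - (n + 1), congrArg η (by omega)⟩
      · rintro ⟨k, rfl⟩
        exact ⟨n + 1 + k, Set.mem_Ioi.2 (by omega), rfl⟩
    rw [himg] at hn
    obtain ⟨t, ht⟩ := M.exists_eval_of_mem_cl _ hn
    obtain ⟨N, hN⟩ := M.eval_local t
    obtain ⟨c, rfl⟩ := he t
    refine ⟨Nat.pair c N, ?_⟩
    simp only [Nat.unpair_pair]
    rw [← ht]
    refine hN _ _ fun k hk => if_pos (hk.trans_le (Nat.right_le_pair c N))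

/-- Extend a sequence to the left, each new entry being computed from the current sequence by the
function whose index is next in the list. -/
def seqBack {α : Type u} (T : ℕ → (ℕ → α) → α) : List ℕ → (ℕ → α) → ℕ → α
  | [], σ => σ
  | c :: l, σ => seqBack T l (seqCons (T c σ) σ)

theorem seqBack_local {α : Type u} {T : ℕ → (ℕ → α) → α}
    (hT : ∀ c σ τ, (∀ k < c, σ k = τ k) → T c σ = T c τ) (B : ℕ) (l : List ℕ) :
    (∀ c ∈ l, c ≤ B) → ∀ σ τ : ℕ → α, (∀ k ≤ B, σ k = τ k) →
      seqBack T l σ 0 = seqBack T l τ 0 := by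
  induction l with
  | nil => exact fun _ σ τ h => h 0 B.zero_le
  | cons c l ih =>
    intro hl σ τ h
    refine ih (fun d hd => hl d (List.mem_cons_of_mem _ hd)) _ _ fun k hk => ?_
    cases k with
    | zero => exact hT c σ τ fun k hk => h k (hk.le.trans (hl c List.mem_cons_self))
    | succ k => exact h k (by omega)

/-- The list `[w (n + j), …, w n]`. -/
def downList (w : ℕ → ℕ) (n : ℕ) : ℕ → List ℕ
  | 0 => [w n]
  | j + 1 => w (n + j + 1) :: downList w n j

theorem length_downList (w : ℕ → ℕ) (n j : ℕ) : (downList w n j).length = j + 1 := by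
  induction j with
  | zero => rfl
  | succ j ih => simp [downList, ih]

theorem exists_of_mem_downList {w : ℕ → ℕ} {n j c : ℕ} (h : c ∈ downList w n j) :
    ∃ k ≤ n + j, w k = c := by
  induction j with
  | zero => exact ⟨n, le_rfl, (List.mem_singleton.1 h).symm⟩
  | succ j ih =>
    rcases List.mem_cons.1 h with h | h
    · exact ⟨n + j + 1, le_rfl, h.symm⟩
    · obtain ⟨k, hk, hw⟩ := ih h
      exact ⟨k, by omega, hw⟩

theorem seqBack_downList {α : Type u} {T : ℕ → (ℕ → α) → α} {w : ℕ → ℕ} {η : ℕ → α} {n : ℕ}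
    (hw : ∀ i ≥ n, T (w i) (seqDrop (i + 1) η) = η i) (j : ℕ) :
    seqBack T (downList w n j) (seqDrop (n + j + 1) η) = seqDrop n η := by
  induction j with
  | zero =>
    change seqCons (T (w n) (seqDrop (n + 1) η)) (seqDrop (n + 1) η) = _
    rw [hw n le_rfl, seqCons_drop]
  | succ j ih =>
    change seqBack T (downList w n j) (seqCons (T (w (n + j + 1)) (seqDrop (n + j + 1 + 1) η))
      (seqDrop (n + j + 1 + 1) η)) = _
    rw [hw (n + j + 1) (by omega), seqCons_drop, ih]

/-- `c` is the least index of a function computing the `i`-th entry from the later ones. -/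
def IsFirstWitness {α : Type u} (T : ℕ → (ℕ → α) → α) (η : ℕ → α) (i c : ℕ) : Prop :=
  T c (seqDrop (i + 1) η) = η i ∧ ∀ d < c, T d (seqDrop (i + 1) η) ≠ η i

theorem IsFirstWitness.unique {α : Type u} {T : ℕ → (ℕ → α) → α} {η : ℕ → α} {i c d : ℕ}
    (hc : IsFirstWitness T η i c) (hd : IsFirstWitness T η i d) : c = d := by
  rcases lt_trichotomy c d with h | h | h
  · exact (hd.2 c h hc.1).elim
  · exact h
  · exact (hc.2 d h hd.1).elim

/-- The bit recorded about `η` for the query `(i, c, l, b)`: `c` is the first witness of `i`, and,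
unless `b = 0`, bit `b - 1` of the real of the entry computed from the entries after the `i`-th
along `l` is set. Only lists `l` and positions `b` within bounds given by `i` and `c` count. -/
def Recorded {α : Type u} (T : ℕ → (ℕ → α) → α) (r : α → ℕ → Bool) (η : ℕ → α)
    (q : ℕ × ℕ × List ℕ × ℕ) : Prop :=
  IsFirstWitness T η q.1 q.2.1 ∧ q.2.2.1.length ≤ q.1 + 1 ∧
    (∀ c ∈ q.2.2.1, c ≤ q.2.1 + q.1) ∧ q.2.2.2 ≤ q.1 + 1 ∧
    ∀ b, q.2.2.2 = b + 1 → r (seqBack T q.2.2.1 (seqDrop (q.1 + 1) η) 0) b = true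

theorem Recorded.congr {α : Type u} {T : ℕ → (ℕ → α) → α} {r : α → ℕ → Bool}
    (hT : ∀ c σ τ, (∀ k < c, σ k = τ k) → T c σ = T c τ) {η ν : ℕ → α} {q : ℕ × ℕ × List ℕ × ℕ}
    (h : ∀ k, q.1 ≤ k → k < 2 * q.1 + q.2.1 + 2 → η k = ν k) (hη : Recorded T r η q) :
    Recorded T r ν q := by
  obtain ⟨i, c, l, b⟩ := q
  obtain ⟨h1, h2, h3, h4, h5⟩ := hη
  dsimp only at *
  have hd : ∀ k ≤ c + i, seqDrop (i + 1) η k = seqDrop (i + 1) ν k :=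
    fun k hk => h _ (by omega) (by omega)
  have hTd : ∀ d ≤ c, T d (seqDrop (i + 1) η) = T d (seqDrop (i + 1) ν) :=
    fun d hdc => hT d _ _ fun k hk => hd k (by omega)
  have hi : η i = ν i := h i le_rfl (by omega)
  refine ⟨⟨?_, fun d hdc => ?_⟩, h2, h3, h4, fun b' hb' => ?_⟩
  · rw [← hTd c le_rfl, ← hi]
    exact h1.1
  · rw [← hTd d hdc.le, ← hi]
    exact h1.2 d hdc
  · dsimp only
    rw [← seqBack_local hT (c + i) l h3 _ _ hd]
    exact h5 b' hb'

theorem finite_recorded {α : Type u} (T : ℕ → (ℕ → α) → α) (r : α → ℕ → Bool) (η : ℕ → α)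
    (n : ℕ) : {q | q.1 < n ∧ Recorded T r η q}.Finite := by
  have hlist : ∀ m B : ℕ, {l : List ℕ | l.length ≤ m ∧ ∀ c ∈ l, c ≤ B}.Finite := by
    intro m B
    refine ((List.finite_length_le (Fin (B + 1)) m).image (List.map Fin.val)).subset ?_
    rintro l ⟨hl, hB⟩
    refine ⟨l.pmap (fun c hc => ⟨c, hc⟩) fun c hc => Nat.lt_succ_of_le (hB c hc), ?_, ?_⟩
    · simpa using hl
    · simp [List.map_pmap]
  have hfix : ∀ i, {q | q.1 = i ∧ Recorded T r η q}.Finite := by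
    intro i
    by_cases h : ∃ c, IsFirstWitness T η i c
    · obtain ⟨c, hc⟩ := h
      refine (((Set.finite_singleton i).prod ((Set.finite_singleton c).prod
        ((hlist (i + 1) (c + i)).prod (Set.finite_le_nat (i + 1)))))).subset ?_
      rintro ⟨i₁, c₁, l, b⟩ ⟨hi, h1, h2, h3, h4, -⟩
      dsimp only at *
      subst hi
      obtain rfl := h1.unique hc
      exact ⟨rfl, rfl, ⟨h2, h3⟩, h4⟩
    · refine Set.finite_empty.subset ?_
      rintro q ⟨rfl, hq⟩
      exact h ⟨_, hq.1⟩
  refine ((Set.finite_lt_nat n).biUnion fun i _ => hfix i).subset ?_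
  rintro q ⟨hq, hR⟩
  exact Set.mem_biUnion (show q.1 ∈ {i | i < n} from hq) ⟨rfl, hR⟩

theorem eventually_eq_of_recorded_iff {α : Type u} {T : ℕ → (ℕ → α) → α} {r : α → ℕ → Bool}
    (hr : Function.Injective r) {η ν : ℕ → α}
    (hη : ∀ᶠ n in atTop, ∃ c, T c (seqDrop (n + 1) η) = η n) {m : ℕ}
    (h : ∀ q : ℕ × ℕ × List ℕ × ℕ, m ≤ q.1 → (Recorded T r η q ↔ Recorded T r ν q)) :
    ∀ᶠ n in atTop, η n = ν n := by
  classical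
  obtain ⟨n₀, hn₀⟩ := eventually_atTop.1 hη
  have hfirst : ∀ i, ∃ c, max n₀ m ≤ i → IsFirstWitness T η i c := by
    intro i
    by_cases hi : max n₀ m ≤ i
    · have hex := hn₀ i ((le_max_left _ _).trans hi)
      exact ⟨Nat.find hex, fun _ => ⟨Nat.find_spec hex, fun d hd => Nat.find_min hex hd⟩⟩
    · exact ⟨0, fun h => (hi h).elim⟩
  choose w hw using hfirst
  have hwν : ∀ i, max n₀ m ≤ i → IsFirstWitness T ν i (w i) := fun i hi =>
    ((h (i, w i, [], 0) ((le_max_right _ _).trans hi)).1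
      ⟨hw i hi, by simp, by simp, by simp, by simp⟩).1
  refine eventually_atTop.2 ⟨max n₀ m, fun n hn => hr (funext fun b => ?_)⟩
  have htend : Tendsto (fun i => w i + i) atTop atTop :=
    tendsto_atTop_mono (fun i => Nat.le_add_left i (w i)) tendsto_id
  obtain ⟨i, hi, hmax⟩ := high_scores htend (max n b)
  obtain ⟨j, rfl⟩ := Nat.exists_eq_add_of_le ((le_max_left n b).trans hi)
  have hbi : b ≤ n + j := (le_max_right n b).trans hi
  have hl : ∀ c ∈ downList w n j, c ≤ w (n + j) + (n + j) := by
    intro c hc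
    obtain ⟨k, hk, rfl⟩ := exists_of_mem_downList hc
    rcases hk.lt_or_eq with hk | rfl
    · exact (Nat.le_add_right _ k).trans (hmax k hk).le
    · exact Nat.le_add_right _ _
  have key : ∀ ξ : ℕ → α, (∀ i, max n₀ m ≤ i → IsFirstWitness T ξ i (w i)) →
      (Recorded T r ξ (n + j, w (n + j), downList w n j, b + 1) ↔ r (ξ n) b = true) := by
    intro ξ hξ
    have hb := seqBack_downList (T := T) (fun i hi => (hξ i (hn.trans hi)).1) j
    constructor
    · intro hR
      have := hR.2.2.2.2 b rfl
      dsimp only at this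
      rwa [hb] at this
    · intro hR
      refine ⟨hξ _ (by omega), ?_, hl, ?_, fun b' hb' => ?_⟩
      · rw [length_downList]
        dsimp only
        omega
      · dsimp only
        omega
      · obtain rfl : b = b' := by simpa using hb'
        dsimp only
        rw [hb]
        exact hR
  rw [Bool.eq_iff_iff, ← key η hw, ← key ν hwν]
  exact h _ (by dsimp only; omega)

/-- If `λ ≤ 2^ℵ₀` and `Pr★(λ)` holds then `KL(λ, 2)`. -/
theorem prStar_implies_kalikow_two (lam : Cardinal.{u})
    (hle : lam ≤ 2 ^ Cardinal.aleph0.{u}) (h : PrStar lam) :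
    HasKalikow lam 2 := by
  classical
  obtain ⟨M, hM⟩ := h
  obtain ⟨x, y, hxy⟩ : ∃ x y : (2 : Cardinal.{u}).out, x ≠ y :=
    Cardinal.two_le_iff.1 (Cardinal.mk_out 2).ge
  rcases isEmpty_or_nonempty lam.out with he | hne
  · exact ⟨fun _ _ => x, fun η => he.elim (η 0)⟩
  obtain ⟨r, hr⟩ : ∃ r : lam.out → ℕ → Bool, Function.Injective r := by
    have hcard : #lam.out ≤ #(ULift.{u} (ℕ → Bool)) := by
      simpa using hle
    obtain ⟨f⟩ := hcard
    exact ⟨fun a => (f a).down, fun a b hab => f.injective (ULift.ext _ _ hab)⟩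
  obtain ⟨T, hT, hw⟩ := hM.exists_witnesses
  let code : ℕ × ℕ × List ℕ × ℕ → ℕ := fun q =>
    Nat.pair (2 * q.1 + q.2.1 + 2) (Encodable.encode q)
  have hcode : Function.Injective code := fun p q hpq =>
    Encodable.encode_injective (Nat.pair_eq_pair.1 hpq).2
  have hcode_le : ∀ q, 2 * q.1 + q.2.1 + 2 ≤ code q := fun q => Nat.left_le_pair _ _
  let z : lam.out := Classical.arbitrary _
  let pad : (n : ℕ) → (Fin n → lam.out) → ℕ → lam.out := fun n s k =>
    if hk : k < n then s ⟨k, hk⟩ else z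
  let F : (n : ℕ) → (Fin n → lam.out) → (2 : Cardinal.{u}).out := fun n s =>
    if ∃ q, code q = n ∧ Recorded T r (pad n s) q then x else y
  have hpad : ∀ q (ξ : ℕ → lam.out),
      (Recorded T r (pad (code q) fun i => ξ i.1) q ↔ Recorded T r ξ q) := by
    intro q ξ
    have hk : ∀ k, q.1 ≤ k → k < 2 * q.1 + q.2.1 + 2 →
        pad (code q) (fun i => ξ i.1) k = ξ k :=
      fun k _ hk => dif_pos (hk.trans_le (hcode_le q))
    exact ⟨Recorded.congr hT hk, Recorded.congr hT fun k h1 h2 => (hk k h1 h2).symm⟩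
  have hF : ∀ n (ξ : ℕ → lam.out),
      (F n (fun i => ξ i.1) = x ↔ ∃ q, code q = n ∧ Recorded T r ξ q) := by
    intro n ξ
    have : (∃ q, code q = n ∧ Recorded T r (pad n fun i => ξ i.1) q) ↔
        ∃ q, code q = n ∧ Recorded T r ξ q := by
      refine exists_congr fun q => and_congr_right ?_
      rintro rfl
      exact hpad q ξ
    rw [← this]
    by_cases hc : ∃ q, code q = n ∧ Recorded T r (pad n fun i => ξ i.1) q
    · exact ⟨fun _ => hc, fun _ => if_pos hc⟩
    · exact ⟨fun h => (hxy (h.symm.trans (if_neg hc))).elim, fun h => (hc h).elim⟩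
  have hFxy : ∀ n s, F n s = x ∨ F n s = y := fun n s => ite_eq_or_eq _ _ _
  refine ⟨F, fun η ν => ⟨fun heq => ?_, fun heq => ?_⟩⟩
  · obtain ⟨n, hn⟩ := eventually_atTop.1 heq
    have hfin := ((finite_recorded T r η n).union (finite_recorded T r ν n)).image code
    rw [← Nat.cofinite_eq_atTop]
    filter_upwards [hfin.compl_mem_cofinite] with m hm
    have hiff : (∃ q, code q = m ∧ Recorded T r η q) ↔ ∃ q, code q = m ∧ Recorded T r ν q := by
      constructor
      · rintro ⟨q, rfl, hq⟩
        have hnq : n ≤ q.1 := not_lt.1 fun hlt => hm ⟨q, Or.inl ⟨hlt, hq⟩, rfl⟩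
        exact ⟨q, rfl, hq.congr hT fun k hk _ => hn k (hnq.trans hk)⟩
      · rintro ⟨q, rfl, hq⟩
        have hnq : n ≤ q.1 := not_lt.1 fun hlt => hm ⟨q, Or.inr ⟨hlt, hq⟩, rfl⟩
        exact ⟨q, rfl, hq.congr hT fun k hk _ => (hn k (hnq.trans hk)).symm⟩
    rw [← hF, ← hF] at hiff
    rcases hFxy m fun i => η i.1 with h1 | h1
    · rw [h1, hiff.1 h1]
    · rcases hFxy m fun i => ν i.1 with h2 | h2
      · rw [h2, hiff.2 h2]
      · rw [h1, h2]
  · obtain ⟨m, hm⟩ := eventually_atTop.1 heq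
    refine eventually_eq_of_recorded_iff hr (hw η) (m := m) fun q hq => ?_
    have hex : ∀ ξ : ℕ → lam.out,
        (∃ p, code p = code q ∧ Recorded T r ξ p) ↔ Recorded T r ξ q := fun ξ =>
      ⟨fun ⟨p, hp, hR⟩ => hcode hp ▸ hR, fun hR => ⟨q, rfl, hR⟩⟩
    have hmq : m ≤ code q := by
      have := hcode_le q
      omega
    rw [← hex, ← hex, ← hF, ← hF, hm _ hmq]
end

section
/- For every natural number n, if ℵ_n ≤ 2^ℵ₀ then the pair (ℵ_n, 2) has the Kalikow property. -/
open Cardinal Filter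

universe u v

namespace Kalikow

variable {X κ : Type*}

/-- The `n`-th value of `Φ η` depends only on `η 0, …, η n`. -/
def Causal {Y : Type*} (Φ : (ℕ → X) → ℕ → Y) : Prop :=
  ∀ η ν n, (∀ i ≤ n, η i = ν i) → Φ η n = Φ ν n

/-- There is a causal map to binary sequences preserving and reflecting eventual equality. -/
def BinaryCode (X : Type*) : Prop :=
  ∃ Φ : (ℕ → X) → ℕ → Bool, Causal Φ ∧ ∀ η ν, Φ η =ᶠ[atTop] Φ ν ↔ η =ᶠ[atTop] ν

/-- `S` is a causal assignment of finite lists, invariant up to eventual equality, which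
infinitely often covers all the terms of a sequence between a fixed place and the present. -/
structure IsCover (S : (ℕ → X) → ℕ → List X) : Prop where
  causal : Causal S
  tail : ∀ η ν, η =ᶠ[atTop] ν → S η =ᶠ[atTop] S ν
  cover : ∀ η, ∃ i₀, ∀ N, ∃ k ≥ N, ∀ i, i₀ ≤ i → i ≤ k → η i ∈ S η k

theorem BinaryCode.of_map {Y : Type*} (hY : BinaryCode Y) {Ψ : (ℕ → X) → ℕ → Y}
    (hc : Causal Ψ) (hΨ : ∀ η ν, Ψ η =ᶠ[atTop] Ψ ν ↔ η =ᶠ[atTop] ν) : BinaryCode X := by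
  obtain ⟨Φ, hΦc, hΦ⟩ := hY
  refine ⟨fun η => Φ (Ψ η), fun η ν n h => ?_, fun η ν => (hΦ _ _).trans (hΨ η ν)⟩
  exact hΦc _ _ _ fun i hi => hc _ _ _ fun j hj => h j (hj.trans hi)

theorem eventuallyEq_iff_finite {Y : Type*} {a b : ℕ → Y} :
    a =ᶠ[atTop] b ↔ {n | a n ≠ b n}.Finite := by
  rw [EventuallyEq, ← Nat.cofinite_eq_atTop, eventually_cofinite]

theorem binaryCode_of_countable [Countable X] : BinaryCode X := by
  classical
  obtain ⟨c, hc⟩ := exists_injective_nat X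
  refine ⟨fun η n => decide (c (η n.unpair.1) = n.unpair.2), fun η ν n h => ?_, fun η ν => ?_⟩
  · simp only [h _ (Nat.unpair_left_le n)]
  rw [eventuallyEq_iff_finite, eventuallyEq_iff_finite]
  constructor
  · intro h
    refine Set.Finite.of_injOn (f := fun i => Nat.pair i (c (η i))) (fun i hi => ?_) ?_ h
    · have : c (ν i) ≠ c (η i) := fun h => hi (hc h).symm
      simpa using this
    · intro i _ j _ hij
      exact (Nat.pair_eq_pair.1 hij).1
  · intro h
    refine ((h.image fun i => Nat.pair i (c (η i))).union
      (h.image fun i => Nat.pair i (c (ν i)))).subset fun n hn => ?_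
    have hne : η n.unpair.1 ≠ ν n.unpair.1 := fun h => hn (by simp only [h])
    by_cases h1 : c (η n.unpair.1) = n.unpair.2
    · exact Or.inl ⟨n.unpair.1, hne, by simp [h1]⟩
    · by_cases h2 : c (ν n.unpair.1) = n.unpair.2
      · exact Or.inr ⟨n.unpair.1, hne, by simp [h2]⟩
      · exact absurd (by simp [h1, h2]) hn

theorem exists_ge_forall_le_add (a : ℕ → ℕ) (N : ℕ) : ∃ k ≥ N, ∀ i ≤ k, a i ≤ k + a k := by
  classical
  obtain ⟨M, hM⟩ : ∃ M, ∀ i ≤ N, a i ≤ M :=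
    ⟨(Finset.range (N + 1)).sup a, fun i hi => Finset.le_sup (by simpa using Nat.lt_succ_of_le hi)⟩
  by_cases h : ∃ k, M < a k
  · refine ⟨Nat.find h, ?_, fun i hi => ?_⟩
    · by_contra! hlt
      exact absurd (Nat.find_spec h) (not_lt.2 (hM _ hlt.le))
    · rcases hi.lt_or_eq with hi | rfl
      · have := Nat.find_min h hi
        have : M < a (Nat.find h) := Nat.find_spec h
        omega
      · omega
  · push Not at h
    exact ⟨max N M, le_max_left _ _, fun i _ =>
      (h i).trans ((le_max_right N M).trans (Nat.le_add_right _ _))⟩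

theorem exists_isCover_of_countable [Countable X] : ∃ S, IsCover (X := X) S := by
  classical
  obtain ⟨_⟩ := nonempty_encodable X
  refine ⟨fun η k => (List.range (k + Encodable.encode (η k) + 1)).filterMap Encodable.decode,
    fun η ν n h => by simp only [h n le_rfl], fun η ν h => ?_, fun η => ⟨0, fun N => ?_⟩⟩
  · filter_upwards [h] with n hn
    simp only [hn]
  obtain ⟨k, hk, h⟩ := exists_ge_forall_le_add (fun i => Encodable.encode (η i)) N
  refine ⟨k, hk, fun i _ hi => List.mem_filterMap.2 ⟨Encodable.encode (η i), ?_, by simp⟩⟩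
  exact List.mem_range.2 (Nat.lt_succ_of_le (h i hi))

section Next

variable [LinearOrder X]

/-- `t` is the first place after `i` where the value of `η` is at least `η i`. -/
def IsNext (η : ℕ → X) (i t : ℕ) : Prop :=
  i < t ∧ η i ≤ η t ∧ ∀ u, i < u → u < t → η u < η i

theorem IsNext.unique {η : ℕ → X} {i t t' : ℕ} (h : IsNext η i t) (h' : IsNext η i t') :
    t = t' := by
  rcases lt_trichotomy t t' with hlt | rfl | hlt
  · exact absurd (h'.2.2 t h.1 hlt) (not_lt.2 h.2.1)
  · rfl
  · exact absurd (h.2.2 t' h'.1 hlt) (not_lt.2 h'.2.1)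

theorem IsNext.congr {η ν : ℕ → X} {i t : ℕ} (h : ∀ u, i ≤ u → u ≤ t → η u = ν u) :
    IsNext η i t ↔ IsNext ν i t := by
  by_cases hit : i < t
  · have hi := h i le_rfl hit.le
    have ht := h t hit.le le_rfl
    unfold IsNext
    rw [hi, ht]
    refine and_congr_right fun _ => and_congr_right fun _ => forall_congr' fun u =>
      forall_congr' fun hu => forall_congr' fun hu' => ?_
    rw [h u hu.le hu'.le]
  · exact ⟨fun h => absurd h.1 hit, fun h => absurd h.1 hit⟩

theorem eventually_not_isNext (η : ℕ → X) (N : ℕ) :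
    ∀ᶠ t in atTop, ∀ i < N, ¬ IsNext η i t := by
  refine (Filter.eventually_all_finite (Set.finite_lt_nat N)).2 fun i _ => ?_
  by_cases h : ∃ t, IsNext η i t
  · obtain ⟨t, ht⟩ := h
    filter_upwards [eventually_gt_atTop t] with s hs hs'
    exact hs.ne (ht.unique hs')
  · exact Eventually.of_forall fun t ht => h ⟨t, ht⟩

theorem exists_forall_exists_isNext [WellFoundedLT X] (η : ℕ → X) :
    ∃ i₀, ∀ i ≥ i₀, ∃ t, IsNext η i t := by
  classical
  have key : ∃ i₀, ∀ i ≥ i₀, ∃ t, i < t ∧ η i ≤ η t := by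
    by_contra! h
    obtain ⟨x, ⟨i, hi, rfl⟩, hmin⟩ := wellFounded_lt.has_min (r := ((· < ·) : X → X → Prop))
      (η '' {i | ∀ t, i < t → η t < η i}) (by
        obtain ⟨i, -, hi⟩ := h 0
        exact ⟨_, i, hi, rfl⟩)
    obtain ⟨i', hi', hbad⟩ := h (i + 1)
    exact hmin _ ⟨i', hbad, rfl⟩ (hi i' hi')
  obtain ⟨i₀, h⟩ := key
  refine ⟨i₀, fun i hi => ⟨Nat.find (h i hi), (Nat.find_spec (h i hi)).1,
    (Nat.find_spec (h i hi)).2, fun u hu hut => ?_⟩⟩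
  by_contra! hle
  exact Nat.find_min (h i hi) hut ⟨hu, hle⟩

theorem exists_last_max (η : ℕ → X) {i k : ℕ} (hik : i ≤ k) :
    ∃ m, i ≤ m ∧ m ≤ k ∧ (∀ u, i ≤ u → u ≤ k → η u ≤ η m) ∧ ∀ u, m < u → u ≤ k → η u < η m := by
  induction k, hik using Nat.le_induction with
  | base =>
    refine ⟨i, le_rfl, le_rfl, fun u h h' => ?_, fun u h h' => by omega⟩
    rw [le_antisymm h' h]
  | succ k hk ih =>
    obtain ⟨m, him, hmk, hmax, hlast⟩ := ih
    rcases le_or_gt (η m) (η (k + 1)) with h | h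
    · refine ⟨k + 1, by omega, le_rfl, fun u hu hu' => ?_, fun u hu hu' => by omega⟩
      rcases hu'.lt_or_eq with hlt | rfl
      · exact (hmax u hu (by omega)).trans h
      · rfl
    · refine ⟨m, him, by omega, fun u hu hu' => ?_, fun u hu hu' => ?_⟩
      · rcases hu'.lt_or_eq with hlt | rfl
        · exact hmax u hu (by omega)
        · exact h.le
      · rcases hu'.lt_or_eq with hlt | rfl
        · exact hlast u hu (by omega)
        · exact h

open Classical in
/-- At time `t`, record the code of `η i` relative to `η t`, for all `i` with next place `t`. -/
noncomputable def nextCode (e : X → X → κ) (η : ℕ → X) (t : ℕ) : List (Option κ) :=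
  (List.range t).map fun i => if IsNext η i t then some (e (η t) (η i)) else none

variable {e : X → X → κ} {η ν : ℕ → X}

open Classical in
theorem causal_nextCode : Causal (nextCode e) := by
  intro η ν t h
  refine List.map_congr_left fun i hi => ?_
  have hi : i < t := List.mem_range.1 hi
  exact if_congr (IsNext.congr fun u _ hu => h u hu) (by rw [h t le_rfl, h i hi.le]) rfl

open Classical in
theorem nextCode_tail (h : η =ᶠ[atTop] ν) : nextCode e η =ᶠ[atTop] nextCode e ν := by
  obtain ⟨N, hN⟩ := eventually_atTop.1 h
  filter_upwards [eventually_ge_atTop N, eventually_not_isNext η N, eventually_not_isNext ν N]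
    with t ht h1 h2
  refine List.map_congr_left fun i _ => ?_
  by_cases hi : i < N
  · rw [if_neg (h1 i hi), if_neg (h2 i hi)]
  · exact if_congr (IsNext.congr fun u hu _ => hN u (by omega))
      (by rw [hN t ht, hN i (by omega)]) rfl

theorem nextCode_getElem?_eq_some {i t : ℕ} :
    (∃ a, (nextCode e η t)[i]? = some (some a)) ↔ IsNext η i t := by
  by_cases hi : i < t
  · by_cases h : IsNext η i t <;> simp [nextCode, hi, h]
  · have : ¬ IsNext η i t := fun h => hi h.1
    simp [nextCode, hi, this]

theorem IsNext.of_nextCode_eq {i t : ℕ} (h : IsNext η i t)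
    (heq : nextCode e η t = nextCode e ν t) :
    IsNext ν i t ∧ e (ν t) (ν i) = e (η t) (η i) ∧
      some (e (η t) (η i)) ∈ nextCode e η t := by
  have hi : i ∈ List.range t := List.mem_range.2 h.1
  have := List.map_inj_left.1 heq i hi
  rw [if_pos h] at this
  by_cases h' : IsNext ν i t
  · rw [if_pos h'] at this
    exact ⟨h', (Option.some.inj this).symm, List.mem_map.2 ⟨i, hi, if_pos h⟩⟩
  · rw [if_neg h'] at this
    cases this

end Next

/-- All compositions of at most `T` of the maps `dec a` for `a ∈ A`. -/
def terms (dec : Option κ → X → X) (A : List (Option κ)) : ℕ → List (X → X)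
  | 0 => [id]
  | T + 1 => terms dec A T ++ (terms dec A T).flatMap fun τ => A.map fun a => dec a ∘ τ

theorem id_mem_terms (dec : Option κ → X → X) (A : List (Option κ)) (T : ℕ) :
    id ∈ terms dec A T := by
  induction T with
  | zero => simp [terms]
  | succ T ih => exact List.mem_append_left _ ih

theorem exists_term [LinearOrder X] {e : X → X → κ} {dec : Option κ → X → X}
    (hdec : ∀ α β, α ≤ β → dec (some (e β α)) β = α) {η ν : ℕ → X} {Q : List (List (Option κ))}
    {m : ℕ} (T : ℕ) {i : ℕ} (him : i ≤ m) (hmax : ∀ u, i ≤ u → u ≤ m → η u ≤ η m)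
    (hnext : ∀ u, i ≤ u → ∃ t, IsNext η u t)
    (hq : ∀ u, i < u → u ≤ m → nextCode e η u = nextCode e ν u ∧ nextCode e η u ∈ Q)
    (hT : m ≤ T + i) :
    ∃ τ ∈ terms dec Q.flatten T, τ (η m) = η i ∧ τ (ν m) = ν i := by
  induction T generalizing i with
  | zero =>
    obtain rfl : i = m := by omega
    exact ⟨id, id_mem_terms _ _ _, rfl, rfl⟩
  | succ T ih =>
    rcases him.lt_or_eq with hlt | rfl
    · obtain ⟨t, ht⟩ := hnext i le_rfl
      have hit := ht.1
      have htm : t ≤ m := by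
        by_contra! hmt
        exact absurd (ht.2.2 m hlt hmt) (not_lt.2 (hmax i le_rfl him))
      obtain ⟨τ, hτ, h1, h2⟩ := ih htm (fun u hu => hmax u (by omega))
        (fun u hu => hnext u (by omega)) (fun u hu => hq u (by omega)) (by omega)
      obtain ⟨heq, hmem⟩ := hq t hit htm
      obtain ⟨ht', hcode, hsome⟩ := ht.of_nextCode_eq heq
      refine ⟨dec (some (e (η t) (η i))) ∘ τ, List.mem_append_right _ (List.mem_flatMap.2
        ⟨τ, hτ, List.mem_map.2 ⟨_, List.mem_flatten.2 ⟨_, hmem, hsome⟩, rfl⟩⟩), ?_, ?_⟩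
      · rw [Function.comp_apply, h1, hdec _ _ ht.2.1]
      · rw [Function.comp_apply, h2, ← hcode, hdec _ _ ht'.2.1]
    · exact ⟨id, id_mem_terms _ _ _, rfl, rfl⟩

open Classical in
/-- The pairs `(u, τ)` such that `τ (η u)` is inspected at time `t`. -/
noncomputable def probes (dec : Option κ → X → X)
    (S : (ℕ → List (Option κ)) → ℕ → List (List (Option κ))) (q : ℕ → List (Option κ)) (t : ℕ) :
    List (ℕ × (X → X)) :=
  (List.range t).flatMap fun i => if ∃ a, (q t)[i]? = some (some a) then
    (List.range t).flatMap fun k => if i ≤ k then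
      (List.range (t + 1)).flatMap fun u => if i ≤ u then
        (terms dec (S q k).flatten t).map fun τ => (u, τ)
      else [] else [] else []

section Probes

variable {dec : Option κ → X → X} {S : (ℕ → List (Option κ)) → ℕ → List (List (Option κ))}

theorem mem_probes {q : ℕ → List (Option κ)} {t u : ℕ} {τ : X → X} :
    (u, τ) ∈ probes dec S q t ↔ ∃ i < t, (∃ a, (q t)[i]? = some (some a)) ∧
      ∃ k < t, i ≤ k ∧ u ≤ t ∧ i ≤ u ∧ τ ∈ terms dec (S q k).flatten t := by
  simp only [probes, List.mem_flatMap, List.mem_range, List.mem_ite_nil_right, List.mem_map,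
    Prod.mk.injEq, Nat.lt_succ_iff]
  constructor
  · rintro ⟨i, hi, ha, k, hk, hik, u', hu, hiu, τ', hτ, rfl, rfl⟩
    exact ⟨i, hi, ha, k, hk, hik, hu, hiu, hτ⟩
  · rintro ⟨i, hi, ha, k, hk, hik, hu, hiu, hτ⟩
    exact ⟨i, hi, ha, k, hk, hik, u, hu, hiu, τ, hτ, rfl, rfl⟩

theorem probes_congr {q q' : ℕ → List (Option κ)} {t : ℕ} (ht : q t = q' t)
    (h : ∀ i k, (∃ a, (q t)[i]? = some (some a)) → i ≤ k → k < t → S q k = S q' k) :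
    probes dec S q t = probes dec S q' t := by
  unfold probes
  rw [← ht]
  refine List.flatMap_congr fun i _ => ?_
  split_ifs with ha
  · refine List.flatMap_congr fun k hk => ?_
    split_ifs with hik
    · rw [h i k ha hik (List.mem_range.1 hk)]
    · rfl
  · rfl

theorem causal_probes (hS : IsCover S) : Causal (probes dec S) := fun _ _ t h =>
  probes_congr (h t le_rfl) fun _ _ _ _ hk =>
    hS.causal _ _ _ fun j hj => h j (hj.trans hk.le)

variable [LinearOrder X] {e : X → X → κ} {η ν : ℕ → X}

theorem probes_tail (hS : IsCover S) (h : nextCode e η =ᶠ[atTop] nextCode e ν) :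
    probes dec S (nextCode e η) =ᶠ[atTop] probes dec S (nextCode e ν) := by
  obtain ⟨N, hN⟩ := eventually_atTop.1 (hS.tail _ _ h)
  filter_upwards [h, eventually_not_isNext η N] with t ht hnot
  refine probes_congr ht fun i k ha hik _ => hN k ?_
  rw [nextCode_getElem?_eq_some] at ha
  by_contra! hk
  exact hnot i (by omega) ha

theorem eventually_le_of_mem_probes (N : ℕ) :
    ∀ᶠ t in atTop, ∀ p ∈ probes dec S (nextCode e η) t, N ≤ p.1 := by
  filter_upwards [eventually_not_isNext η N] with t hnot
  rintro ⟨u, τ⟩ hp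
  obtain ⟨i, _, ha, _, _, _, _, hiu, _⟩ := mem_probes.1 hp
  rw [nextCode_getElem?_eq_some] at ha
  by_contra! hu
  exact hnot i (by simp only at hu; omega) ha

/-- Apply a probing map to the sequence `η`, through an observable `g`. -/
noncomputable def observe {Z : Type*} (dec : Option κ → X → X)
    (S : (ℕ → List (Option κ)) → ℕ → List (List (Option κ))) (e : X → X → κ) (g : ℕ → X → Z)
    (η : ℕ → X) (t : ℕ) : List Z :=
  (probes dec S (nextCode e η) t).map fun p => g t (p.2 (η p.1))

theorem causal_observe {Z : Type*} {g : ℕ → X → Z} (hS : IsCover S) :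
    Causal (observe dec S e g) := by
  intro η ν t h
  have hp : probes dec S (nextCode e η) t = probes dec S (nextCode e ν) t :=
    causal_probes hS _ _ _ fun i hi => causal_nextCode _ _ _ fun j hj => h j (hj.trans hi)
  unfold observe
  rw [← hp]
  refine List.map_congr_left ?_
  rintro ⟨u, τ⟩ hu
  obtain ⟨_, _, _, _, _, _, hut, _⟩ := mem_probes.1 hu
  simp only [h u hut]

theorem observe_tail {Z : Type*} {g : ℕ → X → Z} (hS : IsCover S) (h : η =ᶠ[atTop] ν) :
    observe dec S e g η =ᶠ[atTop] observe dec S e g ν := by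
  obtain ⟨N, hN⟩ := eventually_atTop.1 h
  filter_upwards [probes_tail (dec := dec) hS (nextCode_tail (e := e) h),
    eventually_le_of_mem_probes (dec := dec) (S := S) (e := e) (η := η) N] with t hp hle
  unfold observe
  rw [← hp]
  exact List.map_congr_left fun p hpm => by rw [hN p.1 (hle p hpm)]

variable [WellFoundedLT X]

theorem isCover_observe (hS : IsCover S) (hdec : ∀ α β, α ≤ β → dec (some (e β α)) β = α) :
    IsCover (observe dec S e fun _ => id) where
  causal := causal_observe hS
  tail _ _ := observe_tail hS
  cover η := by
    obtain ⟨i₁, h₁⟩ := hS.cover (nextCode e η)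
    obtain ⟨i₂, h₂⟩ := exists_forall_exists_isNext η
    refine ⟨max i₁ i₂, fun N => ?_⟩
    obtain ⟨k, hk, hcov⟩ := h₁ (max N (max i₁ i₂))
    obtain ⟨m, him, hmk, hmax, hlast⟩ := exists_last_max η ((le_max_right _ _).trans hk)
    obtain ⟨t, ht⟩ := h₂ m (by omega)
    have hkt : k < t := by
      by_contra! htk
      exact absurd (hlast t ht.1 htk) (not_lt.2 ht.2.1)
    refine ⟨t, by omega, fun i hi hit => List.mem_map.2 ?_⟩
    rcases le_total m i with hmi | hmi
    · exact ⟨(i, id), mem_probes.2 ⟨m, ht.1, nextCode_getElem?_eq_some.2 ht, k, hkt, hmk, hit, hmi,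
        id_mem_terms _ _ _⟩, rfl⟩
    · obtain ⟨τ, hτ, h, -⟩ := exists_term (Q := S (nextCode e η) k) (ν := η) hdec t hmi
        (fun u hu hu' => hmax u (by omega) (by omega)) (fun u hu => h₂ u (by omega))
        (fun u hu hu' => ⟨rfl, hcov u (by omega) (by omega)⟩) (by omega)
      exact ⟨(m, τ), mem_probes.2 ⟨m, ht.1, nextCode_getElem?_eq_some.2 ht, k, hkt, hmk, ht.1.le,
        le_rfl, hτ⟩, h⟩

theorem eventuallyEq_of_observe (hS : IsCover S)
    (hdec : ∀ α β, α ≤ β → dec (some (e β α)) β = α) {r : X → ℕ → Bool}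
    (hr : Function.Injective r) (hq : nextCode e η =ᶠ[atTop] nextCode e ν)
    (ho : observe dec S e (fun t x => (List.range t).map (r x)) η =ᶠ[atTop]
      observe dec S e (fun t x => (List.range t).map (r x)) ν) : η =ᶠ[atTop] ν := by
  obtain ⟨i₁, h₁⟩ := hS.cover (nextCode e η)
  obtain ⟨i₂, h₂⟩ := exists_forall_exists_isNext η
  obtain ⟨i₃, h₃⟩ := eventually_atTop.1 (hq.and (ho.and (probes_tail (dec := dec) hS hq)))
  refine eventually_atTop.2 ⟨max i₁ (max i₂ i₃), fun i hi => hr (funext fun d => ?_)⟩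
  obtain ⟨k, hk, hcov⟩ := h₁ (max d i)
  obtain ⟨m, him, hmk, hmax, hlast⟩ := exists_last_max η ((le_max_right _ _).trans hk)
  obtain ⟨t, ht⟩ := h₂ m (by omega)
  have hkt : k < t := by
    by_contra! htk
    exact absurd (hlast t ht.1 htk) (not_lt.2 ht.2.1)
  obtain ⟨τ, hτ, h, h'⟩ := exists_term (Q := S (nextCode e η) k) (ν := ν) hdec t him
    (fun u hu hu' => hmax u (by omega) (by omega)) (fun u hu => h₂ u (by omega))
    (fun u hu hu' => ⟨(h₃ u (by omega)).1, hcov u (by omega) (by omega)⟩) (by omega)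
  obtain ⟨-, hobs, hp⟩ := h₃ t (by omega)
  unfold observe at hobs
  rw [← hp] at hobs
  have := List.map_inj_left.1 hobs (m, τ) (mem_probes.2 ⟨m, ht.1, nextCode_getElem?_eq_some.2 ht,
    k, hkt, hmk, ht.1.le, le_rfl, hτ⟩)
  simp only [h, h'] at this
  exact List.map_inj_left.1 this d (List.mem_range.2 (by omega))

theorem binaryCode_of_observe (hS : IsCover S)
    (hdec : ∀ α β, α ≤ β → dec (some (e β α)) β = α) {r : X → ℕ → Bool}
    (hr : Function.Injective r) (hY : BinaryCode (List (Option κ) × List (List Bool))) :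
    BinaryCode X := by
  refine hY.of_map (Ψ := fun η t =>
    (nextCode e η t, observe dec S e (fun t x => (List.range t).map (r x)) η t)) ?_ ?_
  · intro η ν t h
    exact congrArg₂ Prod.mk (causal_nextCode _ _ _ h) (causal_observe hS _ _ _ h)
  · intro η ν
    constructor
    · intro h
      exact eventuallyEq_of_observe hS hdec hr (h.fun_comp Prod.fst) (h.fun_comp Prod.snd)
    · intro h
      filter_upwards [nextCode_tail (e := e) h, observe_tail (dec := dec) (e := e)
        (g := fun t x => (List.range t).map (r x)) hS h] with t h1 h2
      exact congrArg₂ Prod.mk h1 h2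

end Probes

theorem exists_decoder [Preorder X] (h : ∀ β : X, Nonempty (Set.Iic β ↪ κ)) :
    ∃ (e : X → X → κ) (dec : Option κ → X → X), ∀ α β, α ≤ β → dec (some (e β α)) β = α := by
  classical
  let f : ∀ β : X, Set.Iic β ↪ κ := fun β => (h β).some
  refine ⟨fun β α => if hα : α ≤ β then f β ⟨α, hα⟩ else f β ⟨β, le_rfl⟩,
    fun a β => if ha : ∃ α : Set.Iic β, some (f β α) = a then ha.choose else β, fun α β hα => ?_⟩
  have ha : ∃ x : Set.Iic β, some (f β x) = some (f β ⟨α, hα⟩) := ⟨⟨α, hα⟩, rfl⟩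
  simp only [dif_pos hα, dif_pos ha]
  rw [(f β).injective (Option.some.inj ha.choose_spec)]

theorem exists_wellOrder {X : Type u} {c : Cardinal.{u}} (hc : ℵ₀ ≤ c) (hX : #X ≤ Order.succ c) :
    ∃ _ : LinearOrder X, WellFoundedLT X ∧ ∀ β : X, Nonempty (Set.Iic β ↪ c.out) := by
  have hZ : #X ≤ #(Order.succ c).ord.ToType := by simpa using hX
  obtain ⟨f⟩ := hZ
  let _ : LinearOrder X := LinearOrder.lift' f f.injective
  refine ⟨inferInstance, ⟨InvImage.wf f wellFounded_lt⟩, fun β => ?_⟩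
  have h1 : #(Set.Iic β) ≤ #(Set.Iic (f β)) :=
    mk_le_of_injective (f := fun x : Set.Iic β => (⟨f x, x.2⟩ : Set.Iic (f β)))
      fun x y h => Subtype.ext (f.injective (congrArg Subtype.val h))
  have h2 : #(Set.Iic (f β)) < Order.succ c := by
    have hlt : #(Set.Iio (f β)) < Order.succ c := by
      simpa using mk_Iio_lt (f β) (by simp)
    rw [← Set.Iio_insert]
    exact mk_insert_le.trans_lt (add_one_lt_of_lt (hc.trans (Order.le_succ c))
      hlt)
  have : #(Set.Iic β) ≤ #c.out := by
    rw [mk_out]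
    exact h1.trans (Order.lt_succ_iff.1 h2)
  exact this

theorem mk_list_option_le {κ : Type u} (hκ : ℵ₀ ≤ #κ) : #(List (Option κ)) ≤ #κ := by
  refine (mk_list_le_max _).trans (max_le hκ ?_)
  rw [mk_option, add_one_eq hκ]

theorem exists_isCover_of_mk_le (n : ℕ) :
    ∀ (X : Type u), #X ≤ aleph n → ∃ S, IsCover (X := X) S := by
  induction n with
  | zero =>
    intro X hX
    have : Countable X := by simpa [mk_le_aleph0_iff] using hX
    exact exists_isCover_of_countable
  | succ n ih =>
    intro X hX
    have hs : #X ≤ Order.succ (aleph n) := by simpa [succ_aleph] using hX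
    obtain ⟨_, _, hemb⟩ := exists_wellOrder (aleph0_le_aleph _) hs
    obtain ⟨e, dec, hdec⟩ := exists_decoder hemb
    obtain ⟨S, hS⟩ := ih (List (Option (aleph.{u} n).out))
      ((mk_list_option_le (by simp)).trans (by simp))
    exact ⟨_, isCover_observe hS hdec⟩

theorem binaryCode_of_mk_le (n : ℕ) :
    ∀ (X : Type u), #X ≤ aleph n → #X ≤ 2 ^ ℵ₀ → BinaryCode X := by
  induction n with
  | zero =>
    intro X hX _
    have : Countable X := by simpa [mk_le_aleph0_iff] using hX
    exact binaryCode_of_countable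
  | succ n ih =>
    intro X hX hX2
    rcases le_or_gt #X (aleph n) with hle | hlt
    · exact ih X hle hX2
    have hs : #X ≤ Order.succ (aleph n) := by simpa [succ_aleph] using hX
    obtain ⟨_, _, hemb⟩ := exists_wellOrder (aleph0_le_aleph _) hs
    obtain ⟨e, dec, hdec⟩ := exists_decoder hemb
    have hY : #(List (Option (aleph.{u} n).out)) ≤ aleph n :=
      (mk_list_option_le (by simp)).trans (by simp)
    obtain ⟨S, hS⟩ := exists_isCover_of_mk_le n _ hY
    obtain ⟨r⟩ : Nonempty (X ↪ (ℕ → Bool)) := by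
      rw [← lift_mk_le']
      simpa using hX2
    have hY' : #(List (Option (aleph.{u} n).out) × List (List Bool)) ≤ aleph n := by
      rw [mk_prod]
      have h2 : lift.{u} #(List (List Bool)) ≤ aleph n := by
        rw [mk_list_eq_aleph0, lift_aleph0]
        exact aleph0_le_aleph _
      calc _ ≤ aleph.{u} n * aleph n := mul_le_mul' (by simpa using hY) h2
        _ = aleph n := mul_eq_self (aleph0_le_aleph _)
    exact binaryCode_of_observe hS hdec r.injective (ih _ hY' (hY'.trans (hlt.le.trans hX2)))

theorem BinaryCode.hasKalikow {lam : Cardinal.{u}} (h : BinaryCode lam.out) :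
    HasKalikow lam 2 := by
  obtain ⟨Φ, hc, hΦ⟩ := h
  obtain ⟨f⟩ : Nonempty (Bool ↪ (2 : Cardinal.{u}).out) := by
    rw [← lift_mk_le']
    simp
  refine ⟨fun n s => f (if hn : 0 < n then
    Φ (fun i => s ⟨min i (n - 1), by omega⟩) (n - 1) else false), fun η ν => ?_⟩
  refine (hΦ η ν).symm.trans ?_
  have key : ∀ (η : ℕ → lam.out) n, Φ (fun i => η (min i n)) n = Φ η n := fun η n =>
    hc _ _ _ fun i hi => by rw [min_eq_left hi]
  conv_rhs => rw [← map_add_atTop_eq_nat 1, eventually_map]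
  refine eventually_congr (Eventually.of_forall fun n => ?_)
  simp [key, f.injective.eq_iff]

end Kalikow

/-- If `ℵ_n ≤ 2^ℵ₀` then `KL(ℵ_n, 2)`. -/
theorem kalikow_aleph_nat_two (n : ℕ)
    (hle : Cardinal.aleph n ≤ 2 ^ Cardinal.aleph0.{u}) :
    HasKalikow (Cardinal.aleph n) 2 := by
  refine (Kalikow.binaryCode_of_mk_le n _ (mk_out _).le ((mk_out _).le.trans ?_)).hasKalikow
  rw [← Cardinal.lift_le.{u}]
  simpa using Cardinal.lift_le.{u_1}.2 hle
end

section
/- (Kalikow) Assume the continuum hypothesis, i.e. 2^ℵ₀ = ℵ₁. Then the pair (ℵ₁, 2) has the Kalikow property. -/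
open Cardinal Filter

universe u v

namespace Kalikow

section Coding

variable {Ω : Type u} [LinearOrder Ω]

/-- A natural number recording the first `K` bits of `x a`, and recursively the codes of those
among the first `K` terms of the enumeration `f a` that lie strictly below `a`. -/
noncomputable def treeCode [WellFoundedLT Ω] (f : Ω → ℕ → Ω) (x : Ω → ℕ → Bool) (K : ℕ)
    (a : Ω) : ℕ :=
  Nat.pair (Encodable.encode (List.ofFn fun j : Fin K => x a j))
    (Encodable.encode (List.ofFn fun k : Fin K =>
      if h : f a k < a then treeCode f x K (f a k) + 1 else 0))
termination_by wellFounded_lt.wrap a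
decreasing_by exact h

open Classical in
/-- If `n` is the first index after `i` with `η i ≤ η n`, this is one plus the least position of
`η i` in the enumeration `f (η n)`; otherwise it is `0`. -/
noncomputable def witness (f : Ω → ℕ → Ω) (η : ℕ → Ω) (i n : ℕ) : ℕ :=
  if h : (∀ j, i < j → j < n → η j < η i) ∧ ∃ k, f (η n) k = η i then Nat.find h.2 + 1 else 0

/-- The list of all witnesses found at stage `n`. -/
noncomputable def witnesses (f : Ω → ℕ → Ω) (η : ℕ → Ω) (n : ℕ) : List ℕ :=
  List.ofFn fun i : Fin n => witness f η i n

/-- The precision used at a stage with a given list of witnesses. -/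
def precision (n : ℕ) (l : List ℕ) : ℕ := n + l.sum

/-- The value emitted at stage `n`. -/
noncomputable def stage [WellFoundedLT Ω] (f : Ω → ℕ → Ω) (x : Ω → ℕ → Bool) (η : ℕ → Ω)
    (n : ℕ) : ℕ :=
  Nat.pair (Encodable.encode (witnesses f η n))
    (treeCode f x (precision n (witnesses f η n)) (η n))

/-- The pair `q` is obtained from `p` by passing, in both coordinates, to the term with the same
index, below `K`, in the respective enumerations. -/
def PairStep (f : Ω → ℕ → Ω) (K : ℕ) (p q : Ω × Ω) : Prop :=
  ∃ k < K, q = (f p.1 k, f p.2 k)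

variable {f : Ω → ℕ → Ω} {x : Ω → ℕ → Bool}

theorem treeCode_bits [WellFoundedLT Ω] {K : ℕ} {a b : Ω}
    (h : treeCode f x K a = treeCode f x K b) {j : ℕ} (hj : j < K) : x a j = x b j := by
  rw [treeCode, treeCode, Nat.pair_eq_pair] at h
  exact congrFun (List.ofFn_injective (Encodable.encode_injective h.1)) ⟨j, hj⟩

theorem treeCode_step [WellFoundedLT Ω] (hf : ∀ a k, f a k ≤ a) {K : ℕ} {a b : Ω}
    (h : treeCode f x K a = treeCode f x K b) {k : ℕ} (hk : k < K) :
    treeCode f x K (f a k) = treeCode f x K (f b k) := by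
  have h' := h
  rw [treeCode, treeCode, Nat.pair_eq_pair] at h'
  have := congrFun (List.ofFn_injective (Encodable.encode_injective h'.2)) ⟨k, hk⟩
  dsimp only at this
  split_ifs at this with ha hb hb
  · omega
  · rwa [(hf a k).antisymm (not_lt.1 ha), (hf b k).antisymm (not_lt.1 hb)]

theorem treeCode_reach [WellFoundedLT Ω] (hf : ∀ a k, f a k ≤ a) {K : ℕ} {p q : Ω × Ω}
    (hpq : Relation.ReflTransGen (PairStep f K) p q)
    (h : treeCode f x K p.1 = treeCode f x K p.2) :
    treeCode f x K q.1 = treeCode f x K q.2 := by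
  induction hpq with
  | refl => exact h
  | tail _ hstep ih =>
    obtain ⟨k, hk, rfl⟩ := hstep
    exact treeCode_step hf ih hk

theorem witness_congr {η ν : ℕ → Ω} {i n : ℕ} (hin : i ≤ n)
    (h : ∀ j, i ≤ j → j ≤ n → η j = ν j) : witness f η i n = witness f ν i n := by
  have hi := h i le_rfl hin
  have hiff : (∀ j, i < j → j < n → η j < η i) ↔ ∀ j, i < j → j < n → ν j < ν i := by
    refine forall_congr' fun j => forall_congr' fun h1 => forall_congr' fun h2 => ?_
    rw [h j h1.le h2.le, hi]
  have hk : ∀ k, f (η n) k = η i ↔ f (ν n) k = ν i := fun k => by rw [hi, h n hin le_rfl]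
  unfold witness
  split_ifs with h1 h2 h2
  · exact congrArg (· + 1) (Nat.find_congr' fun {k} => hk k)
  · exact absurd ⟨hiff.1 h1.1, (exists_congr hk).1 h1.2⟩ h2
  · exact absurd ⟨hiff.2 h2.1, (exists_congr hk).2 h2.2⟩ h1
  · rfl

theorem witness_step {η ν : ℕ → Ω} {i n : ℕ} (h0 : witness f η i n ≠ 0)
    (h : witness f η i n = witness f ν i n) :
    PairStep f (witness f η i n) (η n, ν n) (η i, ν i) := by
  have h0' := h ▸ h0
  unfold witness at h h0 h0' ⊢
  split_ifs at h h0 h0' ⊢ with h1 h2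
  · refine ⟨Nat.find h1.2, Nat.lt_succ_self _, ?_⟩
    have e : Nat.find h1.2 = Nat.find h2.2 := by omega
    have s2 := Nat.find_spec h2.2
    rw [← e] at s2
    exact Prod.ext (Nat.find_spec h1.2).symm s2.symm
  all_goals contradiction

/-- Each index has a nonzero witness at no more than one stage. -/
theorem eventually_witness_eq_zero (hf : ∀ a b, b ≤ a ↔ ∃ k, f a k = b) (η : ℕ → Ω) (i : ℕ) :
    ∀ᶠ n in atTop, witness f η i n = 0 := by
  by_cases h : ∃ j, i < j ∧ η i ≤ η j
  · obtain ⟨j, hij, hj⟩ := h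
    filter_upwards [eventually_gt_atTop j] with n hn
    exact dif_neg fun hc => (hc.1 j hij hn).not_ge hj
  · push Not at h
    filter_upwards [eventually_gt_atTop i] with n hn
    exact dif_neg fun hc => (h n hn).not_ge ((hf _ _).2 hc.2)

theorem witnesses_congr {η ν : ℕ → Ω} {n : ℕ}
    (h : ∀ i < n, witness f η i n = witness f ν i n) : witnesses f η n = witnesses f ν n :=
  congrArg List.ofFn (funext fun i : Fin n => h i i.2)

theorem witness_le_precision {η : ℕ → Ω} {i n : ℕ} (h : i < n) :
    witness f η i n ≤ precision n (witnesses f η n) := by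
  have hmem : witness f η i n ∈ witnesses f η n := List.mem_ofFn.2 ⟨⟨i, h⟩, rfl⟩
  exact (List.le_sum_of_mem hmem).trans (Nat.le_add_left _ _)

theorem stage_congr [WellFoundedLT Ω] {η ν : ℕ → Ω} {n : ℕ} (h : ∀ i ≤ n, η i = ν i) :
    stage f x η n = stage f x ν n := by
  have hw : witnesses f η n = witnesses f ν n :=
    witnesses_congr fun i hi => witness_congr hi.le fun j _ hj => h j hj
  rw [stage, stage, hw, h n le_rfl]

theorem stage_eventuallyEq [WellFoundedLT Ω] (hf : ∀ a b, b ≤ a ↔ ∃ k, f a k = b)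
    {η ν : ℕ → Ω} (h : ∀ᶠ n in atTop, η n = ν n) :
    ∀ᶠ n in atTop, stage f x η n = stage f x ν n := by
  obtain ⟨N, hN⟩ := eventually_atTop.1 h
  have hz : ∀ ξ : ℕ → Ω, ∀ᶠ n in atTop, ∀ i ∈ Set.Iio N, witness f ξ i n = 0 := fun ξ =>
    (Set.finite_Iio N).eventually_all.2 fun i _ => eventually_witness_eq_zero hf ξ i
  filter_upwards [hz η, hz ν, eventually_ge_atTop N] with n h1 h2 hn
  have hw : witnesses f η n = witnesses f ν n := witnesses_congr fun i hi => by
    rcases lt_or_ge i N with hiN | hiN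
    · rw [h1 i hiN, h2 i hiN]
    · exact witness_congr hi.le fun j hj _ => hN j (hiN.trans hj)
  rw [stage, stage, hw, hN n hn]

/-- In a sequence in a well-order, almost every term is bounded by some later term. -/
theorem eventually_exists_le [WellFoundedLT Ω] (η : ℕ → Ω) :
    ∀ᶠ i in atTop, ∃ j, i < j ∧ η i ≤ η j := by
  by_contra hcon
  have hfreq : ∃ᶠ i in atTop, ∀ j, i < j → η j < η i := by
    refine Frequently.mono (not_eventually.1 hcon) fun i hi => ?_
    push Not at hi
    exact hi
  obtain ⟨i₀, hi₀⟩ := hfreq.exists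
  obtain ⟨i, hi, hmin⟩ := (InvImage.wf η wellFounded_lt).has_min {i | ∀ j, i < j → η j < η i} ⟨i₀, hi₀⟩
  obtain ⟨j, hj, hij⟩ := (hfreq.and_eventually (eventually_gt_atTop i)).exists
  exact hmin j hj (hi j hij)

theorem eventuallyEq_of_stage [WellFoundedLT Ω] (hf : ∀ a b, b ≤ a ↔ ∃ k, f a k = b)
    (hx : Function.Injective x) {η ν : ℕ → Ω}
    (h : ∀ᶠ n in atTop, stage f x η n = stage f x ν n) : ∀ᶠ n in atTop, η n = ν n := by
  have hle : ∀ a k, f a k ≤ a := fun a k => (hf _ _).2 ⟨k, rfl⟩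
  obtain ⟨N, hN⟩ := eventually_atTop.1 (h.and (eventually_exists_le η))
  set P : ℕ → ℕ := fun n => precision n (witnesses f η n) with hP
  have hws : ∀ n ≥ N, witnesses f η n = witnesses f ν n := fun n hn =>
    Encodable.encode_injective (Nat.pair_eq_pair.1 (hN n hn).1).1
  have hcode : ∀ n ≥ N, treeCode f x (P n) (η n) = treeCode f x (P n) (ν n) := fun n hn => by
    have := (Nat.pair_eq_pair.1 (hN n hn).1).2
    rwa [← hws n hn] at this
  have hnext : ∀ i, ∃ j, N ≤ i → i < j ∧ PairStep f (P j) (η j, ν j) (η i, ν i) := by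
    classical
    intro i
    by_cases hi : N ≤ i
    · have hex := (hN i hi).2
      obtain ⟨hij, hj⟩ := Nat.find_spec hex
      refine ⟨Nat.find hex, fun _ => ⟨hij, ?_⟩⟩
      have h0 : witness f η i (Nat.find hex) ≠ 0 := by
        unfold witness
        rw [dif_pos ⟨fun j h1 h2 => not_le.1 fun h3 => Nat.find_min hex h2 ⟨h1, h3⟩,
          (hf _ _).1 hj⟩]
        exact Nat.succ_ne_zero _
      have he := congrFun (List.ofFn_injective (hws _ (hi.trans hij.le))) ⟨i, hij⟩
      obtain ⟨k, hk, hstep⟩ := witness_step h0 he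
      exact ⟨k, hk.trans_le (witness_le_precision hij), hstep⟩
    · exact ⟨0, fun h => absurd h hi⟩
  choose next hnext using hnext
  refine eventually_atTop.2 ⟨N, fun i hi => hx (funext fun d => ?_)⟩
  set c : ℕ → ℕ := fun l => next^[l] i with hc
  have hsucc : ∀ l, c (l + 1) = next (c l) := fun l => Function.iterate_succ_apply' next l i
  have hcN : ∀ l, N ≤ c l := fun l => by
    induction l with
    | zero => exact hi
    | succ l ih => rw [hsucc]; exact ih.trans (hnext _ ih).1.le
  have hcl : StrictMono c := strictMono_nat_of_lt_succ fun l => by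
    rw [hsucc]; exact (hnext _ (hcN l)).1
  have hreach : ∀ B l, (∀ j ≤ l, P (c j) ≤ B) →
      Relation.ReflTransGen (PairStep f B) (η (c l), ν (c l)) (η i, ν i) := by
    intro B l
    induction l with
    | zero => exact fun _ => Relation.ReflTransGen.refl
    | succ l ih =>
      intro hB
      refine Relation.ReflTransGen.head ?_ (ih fun j hj => hB j (hj.trans l.le_succ))
      obtain ⟨k, hk, hstep⟩ := (hnext _ (hcN l)).2
      rw [← hsucc] at hk hstep
      exact ⟨k, hk.trans_le (hB _ le_rfl), hstep⟩
  classical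
  have hex : ∃ l, d < P (c l) :=
    ⟨d + 1, (Nat.lt_succ_self d).trans_le ((hcl.id_le (d + 1)).trans (Nat.le_add_right _ _))⟩
  have hd := Nat.find_spec hex
  refine treeCode_bits (treeCode_reach hle (hreach _ (Nat.find hex) fun j hj => ?_)
    (hcode _ (hcN _))) hd
  rcases hj.eq_or_lt with rfl | hj
  · exact le_rfl
  · exact (not_lt.1 (Nat.find_min hex hj)).trans hd.le

end Coding

/-- A sequence of natural numbers can be replaced by a two-valued one without changing eventual
equality: the value at `Nat.pair k l` tells whether the `k`-th term is `l`. -/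
theorem eventually_bits_iff (a b : ℕ → ℕ) :
    (∀ᶠ n in atTop, a n = b n) ↔
      ∀ᶠ n in atTop, (a (Nat.unpair n).1 = (Nat.unpair n).2 ↔
        b (Nat.unpair n).1 = (Nat.unpair n).2) := by
  constructor
  · intro h
    obtain ⟨N, hN⟩ := eventually_atTop.1 h
    have hk : ∀ c : ℕ → ℕ, ∀ᶠ n in atTop, ∀ k ∈ Set.Iio N, n ≠ Nat.pair k (c k) := fun c =>
      (Set.finite_Iio N).eventually_all.2 fun k _ => eventually_ne_atTop _
    filter_upwards [hk a, hk b] with n ha hb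
    rcases lt_or_ge (Nat.unpair n).1 N with hn | hn
    · refine iff_of_false (fun h => ha _ hn ?_) fun h => hb _ hn ?_ <;> rw [h, Nat.pair_unpair]
    · rw [hN _ hn]
  · intro h
    obtain ⟨N, hN⟩ := eventually_atTop.1 h
    refine eventually_atTop.2 ⟨N, fun k hk => ?_⟩
    have := hN (Nat.pair k (a k)) (hk.trans (Nat.left_le_pair _ _))
    simp only [Nat.unpair_pair, true_iff] at this
    exact this.symm

/-- A map on sequences of natural number values whose `n`-th value depends only on the terms up to
`n`, and which preserves and reflects eventual equality, yields the Kalikow property. -/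
theorem hasKalikow_two_of_map {lam : Cardinal.{u}} [Nonempty lam.out]
    (Φ : (ℕ → lam.out) → ℕ → ℕ)
    (hloc : ∀ η ν n, (∀ i ≤ n, η i = ν i) → Φ η n = Φ ν n)
    (hΦ : ∀ η ν : ℕ → lam.out,
      (∀ᶠ n in atTop, η n = ν n) ↔ ∀ᶠ n in atTop, Φ η n = Φ ν n) :
    HasKalikow lam 2 := by
  classical
  obtain ⟨p, q, hpq⟩ : ∃ p q : (2 : Cardinal.{u}).out, p ≠ q := by
    have : Nontrivial (2 : Cardinal.{u}).out := by
      rw [← Cardinal.one_lt_iff_nontrivial, Cardinal.mk_out]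
      exact Cardinal.one_lt_two
    exact exists_pair_ne _
  let ext : (n : ℕ) → (Fin n → lam.out) → ℕ → lam.out := fun n s i =>
    if h : i < n then s ⟨i, h⟩ else Classical.arbitrary _
  have hext : ∀ (η : ℕ → lam.out) n,
      Φ (ext (n + 1) fun i => η i) (Nat.unpair n).1 = Φ η (Nat.unpair n).1 := fun η n =>
    hloc _ _ _ fun i hi => dif_pos (Nat.lt_succ_of_le (hi.trans (Nat.unpair_left_le n)))
  refine ⟨fun n s => if Φ (ext n s) (Nat.unpair (n - 1)).1 = (Nat.unpair (n - 1)).2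
    then p else q, fun η ν => ?_⟩
  have hshift : ∀ P : ℕ → Prop, (∀ᶠ n in atTop, P (n + 1)) ↔ ∀ᶠ n in atTop, P n := fun P => by
    conv_rhs => rw [← map_add_atTop_eq_nat 1, eventually_map]
  rw [hΦ, eventually_bits_iff]
  refine Iff.trans (eventually_congr (Eventually.of_forall fun n => ?_))
    (hshift _)
  simp only [Nat.add_sub_cancel, hext]
  split_ifs with h1 h2 h2 <;> simp [h1, h2, hpq, hpq.symm]

/-- The pair `(ℵ₁, 2)` has the Kalikow property; only `ℵ₁ ≤ 2 ^ ℵ₀` is used. -/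
theorem hasKalikow_aleph_one_two : HasKalikow (Cardinal.aleph.{u} 1) 2 := by
  have : Nonempty (Cardinal.aleph.{u} 1).out := by
    rw [← Cardinal.mk_ne_zero_iff, Cardinal.mk_out]
    exact (Cardinal.aleph_pos 1).ne'
  obtain ⟨_, _, hr⟩ := Cardinal.exists_ord_eq_type_lt (Cardinal.aleph.{u} 1).out
  have hcount : ∀ a : (Cardinal.aleph.{u} 1).out, (Set.Iic a).Countable := fun a => by
    rw [← Set.Iio_insert]
    refine Set.Countable.insert a (Cardinal.le_aleph0_iff_set_countable.1 ?_)
    exact Cardinal.lt_aleph_one_iff.1 ((Cardinal.mk_Iio_lt a hr).trans_eq (Cardinal.mk_out _))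
  choose f hf using fun a => (hcount a).exists_eq_range ⟨a, Set.self_mem_Iic⟩
  have hf' : ∀ a b, b ≤ a ↔ ∃ k, f a k = b := fun a b => Set.ext_iff.1 (hf a) b
  obtain ⟨x⟩ : Nonempty ((Cardinal.aleph.{u} 1).out ↪ (ℕ → Bool)) := by
    rw [← Cardinal.lift_mk_le']
    simpa using Cardinal.aleph_one_le_continuum
  exact hasKalikow_two_of_map (stage f x) (fun _ _ _ => stage_congr) fun _ _ =>
    ⟨stage_eventuallyEq hf', eventuallyEq_of_stage hf' x.injective⟩

end Kalikow

/-- (Kalikow) CH implies `KL(ℵ₁, 2)`. -/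
theorem kalikow_aleph_one_of_CH
    (CH : 2 ^ Cardinal.aleph0.{u} = Cardinal.aleph 1) :
    HasKalikow (Cardinal.aleph 1) 2 :=
  Kalikow.hasKalikow_aleph_one_two
end

section
/- (Kalikow) Assume the continuum hypothesis, i.e. 2^ℵ₀ = ℵ₁. Then the pair (2^ℵ₀, 2) has the Kalikow property. -/
open Cardinal Filter

universe u v

theorem WellFoundedLT.exists_rec {W T : Type*} [LT W] [WellFoundedLT W] [Nonempty T]
    (P : (W → T) → W → T → Prop)
    (hlocal : ∀ A A' b t, (∀ a < b, A a = A' a) → P A b t → P A' b t)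
    (hext : ∀ A b, (∀ a < b, P A a (A a)) → ∃ t, P A b t) :
    ∃ A, ∀ b, P A b (A b) := by
  classical
  let extend : (b : W) → ((a : W) → a < b → T) → W → T :=
    fun b f a => if h : a < b then f a h else Classical.arbitrary T
  let step : (b : W) → ((a : W) → a < b → T) → T :=
    fun b f => Classical.epsilon (P (extend b f) b)
  let A : W → T := (wellFounded_lt (α := W)).fix step
  have hA (b : W) : A b = Classical.epsilon (P (extend b fun a _ => A a) b) :=
    (wellFounded_lt (α := W)).fix_eq step b
  have hagree (b : W) : ∀ a < b, extend b (fun a _ => A a) a = A a := fun a h => by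
    simp [extend, h]
  refine ⟨A, fun b => ?_⟩
  induction b using wellFounded_lt (α := W).induction with
  | _ b ih =>
    obtain ⟨t, ht⟩ := hext A b ih
    have hspec := Classical.epsilon_spec (p := P (extend b fun a _ => A a) b)
      ⟨t, hlocal _ _ b t (fun a h => (hagree b a h).symm) ht⟩
    rw [← hA] at hspec
    exact hlocal _ _ b _ (hagree b) hspec

/-- A system of finite sets `A b n` increasing in `n`, with `⋃ n, A b n = Set.Iic b`, such that
`a ∈ A b n` implies `A a n ⊆ A b n`. -/
structure IsCoherentCover {W : Type*} [LinearOrder W] (A : W → ℕ → Finset W) : Prop where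
  self_mem : ∀ b n, b ∈ A b n
  le_of_mem : ∀ {a b n}, a ∈ A b n → a ≤ b
  mono : ∀ b, Monotone (A b)
  trans : ∀ {a b n}, a ∈ A b n → A a n ⊆ A b n
  exists_mem : ∀ {a b}, a ≤ b → ∃ n, a ∈ A b n

/-- The condition for `t` to extend the coherent cover `A` of `Set.Iio b` to the point `b`. -/
structure IsCoverStep {W : Type*} [LinearOrder W] (A : W → ℕ → Finset W) (b : W)
    (t : ℕ → Finset W) : Prop where
  self_mem : ∀ n, b ∈ t n
  le_of_mem : ∀ {n a}, a ∈ t n → a ≤ b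
  mono : Monotone t
  trans : ∀ {n a}, a < b → a ∈ t n → A a n ⊆ t n
  exists_mem : ∀ {a}, a < b → ∃ n, a ∈ t n

theorem exists_isCoverStep {W : Type*} [LinearOrder W] (A : W → ℕ → Finset W) (b : W)
    (hb : (Set.Iio b).Countable) (hA : ∀ a < b, IsCoverStep A a (A a)) :
    ∃ t, IsCoverStep A b t := by
  rcases (Set.Iio b).eq_empty_or_nonempty with he | hne
  · have hlt (a : W) (h : a < b) : False := by
      have : a ∈ Set.Iio b := h
      simp [he] at this
    exact ⟨fun _ => {b}, fun _ => by simp, by simp, fun _ _ _ => le_rfl,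
      fun h => (hlt _ h).elim, fun h => (hlt _ h).elim⟩
  obtain ⟨x, hx⟩ := hb.exists_eq_range hne
  have hxb (i : ℕ) : x i < b := by
    have : x i ∈ Set.Iio b := hx ▸ Set.mem_range_self i
    exact this
  set s : ℕ → W := fun k => partialSups x k with hs
  have hsm : Monotone s := (partialSups x).monotone
  have hsb (k : ℕ) : s k < b := by
    induction k with
    | zero => simpa [hs] using hxb 0
    | succ k ih => simpa [hs, partialSups_add_one] using ⟨ih, hxb (k + 1)⟩
  have htrans {a c : W} {n : ℕ} (hc : c < b) (ha : a ∈ A c n) : A a n ⊆ A c n := by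
    rcases ((hA c hc).le_of_mem ha).eq_or_lt with rfl | h
    · exact le_rfl
    · exact (hA c hc).trans h ha
  let Q : ℕ → ℕ → Prop := fun n k => ∀ j < k, s j ∈ A (s (j + 1)) n
  classical
  let K : ℕ → ℕ := fun n => Nat.findGreatest (Q n) n
  have hQK (n : ℕ) : Q n (K n) :=
    Nat.findGreatest_spec (P := Q n) (Nat.zero_le n) (by simp [Q])
  have hQmono {n n' k : ℕ} (h : n ≤ n') (hq : Q n k) : Q n' k :=
    fun j hj => (hA _ (hsb _)).mono h (hq j hj)
  have hKmono : Monotone K := fun n n' h =>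
    Nat.le_findGreatest ((Nat.findGreatest_le n).trans h) (hQmono h (hQK n))
  have hchain {n k k' : ℕ} (hkk : k ≤ k') (hq : Q n k') : A (s k) n ⊆ A (s k') n := by
    induction k', hkk using Nat.le_induction with
    | base => exact le_rfl
    | succ k' _ ih =>
      exact (ih fun j hj => hq j (by omega)).trans (htrans (hsb _) (hq k' (by omega)))
  have hQex (k : ℕ) : ∃ n, Q n k := by
    induction k with
    | zero => exact ⟨0, by simp [Q]⟩
    | succ k ih =>
      obtain ⟨n, hn⟩ := ih
      obtain ⟨n', hn'⟩ : ∃ n', s k ∈ A (s (k + 1)) n' := by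
        rcases (hsm (Nat.le_succ k)).eq_or_lt with h | h
        · exact ⟨0, h ▸ (hA _ (hsb _)).self_mem 0⟩
        · exact (hA _ (hsb _)).exists_mem h
      refine ⟨max n n', fun j hj => ?_⟩
      rcases Nat.lt_succ_iff_lt_or_eq.mp hj with h | rfl
      · exact hQmono (le_max_left _ _) hn j h
      · exact (hA _ (hsb _)).mono (le_max_right _ _) hn'
  refine ⟨fun n => insert b (A (s (K n)) n), fun n => Finset.mem_insert_self _ _, ?_, ?_, ?_, ?_⟩
  · intro n a ha
    rcases Finset.mem_insert.mp ha with rfl | h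
    · exact le_rfl
    · exact ((hA _ (hsb _)).le_of_mem h).trans (hsb _).le
  · intro n n' h
    exact Finset.insert_subset_insert _
      (((hA _ (hsb _)).mono h).trans (hchain (hKmono h) (hQK n')))
  · intro n a hab ha
    have ha' := (Finset.mem_insert.mp ha).resolve_left hab.ne
    exact (htrans (hsb _) ha').trans (Finset.subset_insert _ _)
  · intro a hab
    obtain ⟨i, rfl⟩ : a ∈ Set.range x := hx ▸ hab
    obtain ⟨n, hn⟩ : ∃ n, x i ∈ A (s i) n := by
      rcases (le_partialSups x i).eq_or_lt with h | h
      · exact ⟨0, h ▸ (hA _ (hxb i)).self_mem 0⟩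
      · exact (hA _ (hsb i)).exists_mem h
    obtain ⟨n', hn'⟩ := hQex i
    let N := max (max n n') i
    have hN : Q N i := hQmono (by omega) hn'
    have hiK : i ≤ K N := Nat.le_findGreatest (by omega) hN
    exact ⟨N, Finset.mem_insert_of_mem
      (hchain hiK (hQK N) ((hA _ (hsb i)).mono (show n ≤ N by omega) hn))⟩

theorem exists_isCoherentCover {W : Type*} [LinearOrder W] [WellFoundedLT W]
    (hW : ∀ b : W, (Set.Iio b).Countable) :
    ∃ A : W → ℕ → Finset W, IsCoherentCover A := by
  obtain ⟨A, hA⟩ := WellFoundedLT.exists_rec (IsCoverStep (W := W))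
    (fun A A' b t h ht => ⟨ht.self_mem, ht.le_of_mem, ht.mono,
      fun hab ha => h _ hab ▸ ht.trans hab ha, ht.exists_mem⟩)
    (fun A b h => exists_isCoverStep A b (hW b) h)
  refine ⟨A, fun b => (hA b).self_mem, (hA _).le_of_mem, fun b => (hA b).mono, ?_, ?_⟩
  · intro a b n ha
    rcases ((hA b).le_of_mem ha).eq_or_lt with rfl | h
    · exact le_rfl
    · exact (hA b).trans h ha
  · intro a b hab
    rcases hab.eq_or_lt with rfl | h
    · exact ⟨0, (hA a).self_mem 0⟩
    · exact (hA b).exists_mem h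

section Capture

variable {W : Type*} {A : W → ℕ → Finset W} {η ν : ℕ → W} {n' l' n m l : ℕ}

/-- The term `η m` belongs to the `n`-th finite set attached to the later term `η l`. -/
def Captured (A : W → ℕ → Finset W) (η : ℕ → W) (n m l : ℕ) : Prop :=
  m < l ∧ l < n ∧ η m ∈ A (η l) n

/-- `n` is the first stage at which `η m` is captured by a later term, and `l` is the last index
capturing it at this stage. -/
def FirstCaptured (A : W → ℕ → Finset W) (η : ℕ → W) (n m l : ℕ) : Prop :=
  Captured A η n m l ∧ (∀ l', Captured A η n m l' → l' ≤ l) ∧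
    ∀ n' < n, ∀ l', ¬ Captured A η n' m l'

theorem FirstCaptured.stage_unique (h : FirstCaptured A η n m l) (h' : FirstCaptured A η n' m l') :
    n = n' := by
  rcases lt_trichotomy n n' with hn | hn | hn
  · exact (h'.2.2 n hn l h.1).elim
  · exact hn
  · exact (h.2.2 n' hn l' h'.1).elim

theorem FirstCaptured.stage_lt [LinearOrder W] (hA : IsCoherentCover A) (h : FirstCaptured A η n m l)
    (h' : FirstCaptured A η n' l l') : n < n' := by
  by_contra! hn
  obtain ⟨⟨hml, hln, hm⟩, hmax, -⟩ := h
  obtain ⟨⟨hll, hln', hl⟩, -⟩ := h'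
  have := hmax l' ⟨by omega, by omega, hA.trans (hA.mono _ hn hl) hm⟩
  omega

theorem exists_firstCaptured [LinearOrder W] (hA : IsCoherentCover A) (hml : m < l) (h : η m ≤ η l) :
    ∃ n l, FirstCaptured A η n m l := by
  classical
  have hex : ∃ n l, Captured A η n m l := by
    obtain ⟨n, hn⟩ := hA.exists_mem h
    exact ⟨max n (l + 1), l, hml, by omega, hA.mono _ (le_max_left _ _) hn⟩
  obtain ⟨k, hk⟩ := Nat.find_spec hex
  set n := Nat.find hex
  refine ⟨n, Nat.findGreatest (Captured A η n m) n,
    Nat.findGreatest_spec (P := Captured A η n m) hk.2.1.le hk,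
    fun l' hl' => Nat.le_findGreatest hl'.2.1.le hl', fun n' hn' l' hl' => ?_⟩
  exact Nat.find_min hex hn' ⟨l', hl'⟩

theorem captured_congr (h : ∀ i, m ≤ i → i < n → η i = ν i) :
    Captured A η n m l ↔ Captured A ν n m l := by
  unfold Captured
  refine and_congr_right fun hml => and_congr_right fun hln => ?_
  rw [h m le_rfl (by omega), h l hml.le hln]

theorem firstCaptured_congr (h : ∀ i, m ≤ i → i < n → η i = ν i) :
    FirstCaptured A η n m l ↔ FirstCaptured A ν n m l := by
  unfold FirstCaptured
  refine and_congr (captured_congr h) (and_congr ?_ ?_)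
  · exact forall_congr' fun l' => imp_congr_left (captured_congr h)
  · exact forall_congr' fun n' => forall_congr' fun hn' => forall_congr' fun l' =>
      not_congr (captured_congr fun i hi hin => h i hi (hin.trans hn'))

theorem eventually_not_firstCaptured (A : W → ℕ → Finset W) (η : ℕ → W) (N : ℕ) :
    ∀ᶠ n in atTop, ∀ m < N, ∀ l, ¬ FirstCaptured A η n m l := by
  refine (Set.finite_Iio N).eventually_all.mpr fun m _ => ?_
  by_cases h : ∃ n l, FirstCaptured A η n m l
  · obtain ⟨n₀, l₀, h₀⟩ := h
    filter_upwards [eventually_gt_atTop n₀] with n hn l hl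
    exact hn.ne (h₀.stage_unique hl)
  · push Not at h
    exact Eventually.of_forall fun n => h n

theorem eventually_exists_le [LinearOrder W] [WellFoundedLT W] (η : ℕ → W) :
    ∀ᶠ m in atTop, ∃ l, m < l ∧ η m ≤ η l := by
  by_contra hcon
  have hfreq : ∃ᶠ m in atTop, ∀ l, m < l → η l < η m :=
    (not_eventually.mp hcon).mono fun m h => by simpa using h
  obtain ⟨m₀, hm₀⟩ := hfreq.exists
  obtain ⟨_, ⟨m, hm, rfl⟩, hmin⟩ := (wellFounded_lt (α := W)).has_min
    (η '' {m | ∀ l, m < l → η l < η m}) ⟨_, m₀, hm₀, rfl⟩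
  obtain ⟨l, hl, hml⟩ := (hfreq.and_eventually (eventually_gt_atTop m)).exists
  exact hmin (η l) ⟨l, hl, rfl⟩ (hm l hml)

end Capture

section Encoding

variable {W : Type*} {A : W → ℕ → Finset W} {e : W → W → ℕ} {r : W → Set ℕ}
  {η ν : ℕ → W} {n m l : ℕ}

/-- The finite data emitted when `a` is captured by `b` at stage `n`: the `e a`-index of `a`, and
for each member of `A a n` its indices with respect to `e a` and `e b` together with the first `n`
bits of its code `r`. -/
noncomputable def captureData (A : W → ℕ → Finset W) (e : W → W → ℕ) (r : W → Set ℕ) (n : ℕ)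
    (a b : W) : ℕ × Finset (ℕ × ℕ × Finset ℕ) :=
  open Classical in
  (e a a, (A a n).image fun c => (e a c, e b c, (Finset.range n).filter (· ∈ r c)))

/-- The data emitted at stage `n` along the sequence `η`. -/
noncomputable def emission (A : W → ℕ → Finset W) (e : W → W → ℕ) (r : W → Set ℕ) (n : ℕ)
    (η : ℕ → W) : Finset (ℕ × ℕ × ℕ × Finset (ℕ × ℕ × Finset ℕ)) :=
  open Classical in
  ((Finset.range n ×ˢ Finset.range n).filter fun p => FirstCaptured A η n p.1 p.2).image
    fun p => (p.1, p.2, captureData A e r n (η p.1) (η p.2))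

theorem mem_emission {x : ℕ × Finset (ℕ × ℕ × Finset ℕ)} :
    (m, l, x) ∈ emission A e r n η ↔
      FirstCaptured A η n m l ∧ captureData A e r n (η m) (η l) = x := by
  classical
  simp only [emission, Finset.mem_image, Finset.mem_filter, Finset.mem_product, Finset.mem_range,
    Prod.mk.injEq, Prod.exists]
  constructor
  · rintro ⟨m, l, ⟨-, h⟩, rfl, rfl, rfl⟩
    exact ⟨h, rfl⟩
  · rintro ⟨h, rfl⟩
    have := h.1.1
    have := h.1.2.1
    exact ⟨m, l, ⟨⟨by omega, by omega⟩, h⟩, rfl, rfl, rfl⟩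

theorem emission_congr (h : ∀ m l, FirstCaptured A η n m l ∨ FirstCaptured A ν n m l →
    ∀ i, m ≤ i → i < n → η i = ν i) : emission A e r n η = emission A e r n ν := by
  ext ⟨m, l, x⟩
  simp only [mem_emission]
  by_cases hc : FirstCaptured A η n m l ∨ FirstCaptured A ν n m l
  · have hi := h m l hc
    have hcap : m < l ∧ l < n := by
      rcases hc with hc | hc <;> exact ⟨hc.1.1, hc.1.2.1⟩
    rw [firstCaptured_congr hi, hi m le_rfl (by omega), hi l (by omega) hcap.2]
  · tauto

theorem eventually_emission_eq (h : ∀ᶠ n in atTop, η n = ν n) :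
    ∀ᶠ n in atTop, emission A e r n η = emission A e r n ν := by
  obtain ⟨N, hN⟩ := eventually_atTop.mp h
  filter_upwards [eventually_not_firstCaptured A η N, eventually_not_firstCaptured A ν N]
    with n hη hν
  refine emission_congr fun m l hc i hi _ => hN i (le_trans ?_ hi)
  by_contra! hm
  exact hc.elim (hη m hm l) (hν m hm l)

theorem eventually_eq_of_emission_eq [LinearOrder W] [WellFoundedLT W] (hA : IsCoherentCover A)
    (he : ∀ b, Set.InjOn (e b) (Set.Iic b)) (hr : Function.Injective r)
    (h : ∀ᶠ n in atTop, emission A e r n η = emission A e r n ν) :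
    ∀ᶠ n in atTop, η n = ν n := by
  obtain ⟨N, hN⟩ := eventually_atTop.mp (h.and (eventually_exists_le η))
  have hcap (m : ℕ) (hm : N ≤ m) : ∃ n l, FirstCaptured A η n m l := by
    obtain ⟨l, hml, hl⟩ := (hN m hm).2
    exact exists_firstCaptured hA hml hl
  have hdata {n m l : ℕ} (hm : N ≤ m) (hc : FirstCaptured A η n m l) :
      FirstCaptured A ν n m l ∧
        captureData A e r n (ν m) (ν l) = captureData A e r n (η m) (η l) := by
    have hmn : m < n := hc.1.1.trans hc.1.2.1
    rw [← mem_emission, ← (hN n (hm.trans hmn.le)).1, mem_emission]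
    exact ⟨hc, rfl⟩
  have key (i d : ℕ) : ∀ m n l, N ≤ m → i ≤ m + d → FirstCaptured A η n m l →
      ∀ c ∈ A (η m) n, ∀ c' ≤ ν m, e (η m) c = e (ν m) c' → (i ∈ r c ↔ i ∈ r c') := by
    classical
    induction d with
    | zero => ?_
    | succ d ih => ?_
    all_goals
      intro m n l hm hi hc c hcA c' hc' hee
      obtain ⟨hcν, hdat⟩ := hdata hm hc
      have hmem : (e (η m) c, e (η l) c, (Finset.range n).filter (· ∈ r c)) ∈
          (captureData A e r n (ν m) (ν l)).2 := by
        rw [hdat]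
        exact Finset.mem_image.mpr ⟨c, hcA, by congr⟩
      obtain ⟨c'', hc'', heq⟩ := Finset.mem_image.mp hmem
      simp only [Prod.mk.injEq] at heq
      obtain ⟨h₁, h₂, h₃⟩ := heq
      obtain rfl : c'' = c' := he (ν m) (hA.le_of_mem hc'') hc' (h₁.trans hee)
      have hml := hc.1.1
      have hln := hc.1.2.1
    · have := congrArg (i ∈ ·) h₃
      simp only [Finset.mem_filter, Finset.mem_range, show i < n by omega, true_and] at this
      exact (iff_of_eq this).symm
    · obtain ⟨n', l', hc₂⟩ := hcap l (by omega)
      have hlt := hc.stage_lt hA hc₂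
      exact ih l n' l' (by omega) (by omega) hc₂ c
        (hA.mono _ hlt.le (hA.trans hc.1.2.2 hcA)) c''
        (hc'.trans (hA.le_of_mem hcν.1.2.2)) h₂.symm
  filter_upwards [eventually_ge_atTop N] with m hm
  obtain ⟨n, l, hc⟩ := hcap m hm
  refine hr (Set.ext fun i => ?_)
  exact key i i m n l hm (by omega) hc _ (hA.self_mem _ _) _ le_rfl
    (congrArg Prod.fst (hdata hm hc).2).symm

end Encoding

theorem hasKalikow_two_of_countable {lam : Cardinal.{u}} [Nonempty lam.out] {C : Type*}
    [Countable C] (G : ℕ → (ℕ → lam.out) → C)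
    (hloc : ∀ n η ν, (∀ i < n, η i = ν i) → G n η = G n ν)
    (hG : ∀ η ν : ℕ → lam.out,
      (∀ᶠ n in atTop, η n = ν n) ↔ ∀ᶠ n in atTop, G n η = G n ν) :
    HasKalikow lam 2 := by
  obtain ⟨g, hg⟩ := exists_injective_nat C
  obtain ⟨b, hb⟩ : ∃ b : Bool → (2 : Cardinal.{u}).out, Function.Injective b := by
    have : #(ULift.{u} Bool) = #(2 : Cardinal.{u}).out := by simp
    obtain ⟨φ⟩ := Cardinal.eq.mp this
    exact ⟨fun x => φ ⟨x⟩, fun x y h => by simpa using h⟩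
  classical
  let extend : (n : ℕ) → (Fin n → lam.out) → ℕ → lam.out :=
    fun n s i => if h : i < n then s ⟨i, h⟩ else Classical.arbitrary _
  have hext (n : ℕ) (η : ℕ → lam.out) (k : ℕ) (hk : k ≤ n) :
      G k (extend n fun i => η i.1) = G k η :=
    hloc k _ _ fun i hi => by simp [extend, hi.trans_le hk]
  refine ⟨fun n s => b ((g (G n.unpair.1 (extend n s))).testBit n.unpair.2), fun η ν => ?_⟩
  simp only [hb.eq_iff, hext _ _ _ (Nat.unpair_left_le _), hG]
  constructor
  · intro h
    obtain ⟨N, hN⟩ := eventually_atTop.mp h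
    have hbit (k : ℕ) : ∀ᶠ j in atTop,
        (g (G k η)).testBit j = (g (G k ν)).testBit j := by
      filter_upwards [eventually_ge_atTop (g (G k η)), eventually_ge_atTop (g (G k ν))]
        with j h₁ h₂
      rw [Nat.testBit_lt_two_pow (h₁.trans_lt Nat.lt_two_pow_self),
        Nat.testBit_lt_two_pow (h₂.trans_lt Nat.lt_two_pow_self)]
    obtain ⟨J, hJ⟩ := eventually_atTop.mp
      ((Set.finite_Iio N).eventually_all.mpr fun k _ => hbit k)
    filter_upwards [eventually_ge_atTop ((max N J + 1) ^ 2)] with n hn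
    by_cases hk : N ≤ n.unpair.1
    · rw [hN _ hk]
    · refine hJ _ ?_ _ (not_le.mp hk)
      by_contra! hj
      have hlt := Nat.pair_lt_max_add_one_sq n.unpair.1 n.unpair.2
      rw [Nat.pair_unpair] at hlt
      have : (max n.unpair.1 n.unpair.2 + 1) ^ 2 ≤ (max N J + 1) ^ 2 :=
        Nat.pow_le_pow_left (by omega) 2
      omega
  · intro h
    obtain ⟨N, hN⟩ := eventually_atTop.mp h
    filter_upwards [eventually_ge_atTop N] with k hk
    refine hg (Nat.eq_of_testBit_eq fun j => ?_)
    simpa using hN (Nat.pair k j) (hk.trans (Nat.left_le_pair k j))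

/-- (Kalikow) CH implies `KL(2^ℵ₀, 2)`. -/
theorem kalikow_continuum_of_CH
    (CH : 2 ^ Cardinal.aleph0.{u} = Cardinal.aleph 1) :
    HasKalikow (2 ^ Cardinal.aleph0.{u}) 2 := by
  let W : Type u := (2 ^ Cardinal.aleph0.{u} : Cardinal.{u}).out
  have hcard : #W = 2 ^ Cardinal.aleph0.{u} := Cardinal.mk_out _
  have hne : Nonempty W := Cardinal.mk_ne_zero_iff.mp (hcard ▸ Cardinal.power_ne_zero _ two_ne_zero)
  obtain ⟨_, _, hord⟩ := Cardinal.exists_ord_eq_type_lt W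
  have hIio (b : W) : (Set.Iio b).Countable := by
    rw [← Cardinal.le_aleph0_iff_set_countable, ← Cardinal.lt_aleph_one_iff, ← CH, ← hcard]
    exact Cardinal.mk_Iio_lt b hord
  obtain ⟨A, hA⟩ := exists_isCoherentCover hIio
  have hIic (b : W) : (Set.Iic b).Countable := by
    rw [← Set.Iio_insert]
    exact (hIio b).insert b
  choose e he using fun b => Set.countable_iff_exists_injOn.mp (hIic b)
  obtain ⟨r, hr⟩ : ∃ r : W → Set ℕ, Function.Injective r := by
    have : #W = #(Set (ULift.{u} ℕ)) := by simp [hcard]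
    obtain ⟨φ⟩ := Cardinal.eq.mp this
    exact ⟨fun a => ULift.down '' φ a,
      (Set.image_injective.mpr ULift.down_injective).comp φ.injective⟩
  refine hasKalikow_two_of_countable (emission A e r)
    (fun n η ν h => emission_congr fun _ _ _ i _ hi => h i hi) fun η ν =>
      ⟨eventually_emission_eq, eventually_eq_of_emission_eq hA he hr⟩
end
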